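/- Let N ∈ ℕ, let λ_1, …, λ_N ∈ [0,1], let φ_1, …, φ_N : ℕ → ℤ, and suppose there exists a strictly increasing sequence (n_k)_{k∈ℕ} in ℕ such that for every ξ = (ξ_1,…,ξ_N) ∈ {0,1}^N there exists an aperiodic T_ξ ∈ Aut([0,1], ℬ, μ) with the property that for each j ∈ {1,…,N} and all measurable A, B ⊆ [0,1], lim_{k→∞} μ(A ∩ T_ξ^{−φ_j(n_k)} B) = (1 − ξ_j) μ(A ∩ B) + ξ_j μ(A) μ(B). Then the set of all T ∈ Aut([0,1], ℬ, μ) for which there exists a strictly increasing sequence (k_ℓ)_{ℓ∈ℕ} in ℕ such that for every j ∈ {1,…,N} and all measurable A, B ⊆ [0,1], lim_{ℓ→∞} μ(A ∩ T^{−φ_j(n_{k_ℓ})} B) = (1 − λ_j) μ(A ∩ B) + λ_j μ(A) μ(B), is a dense G_δ subset of Aut([0,1], ℬ, μ) in the weak topology. -/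

import Mathlib

open MeasureTheory Filter Topology

noncomputable section

/-- An invertible Lebesgue-measure-preserving transformation of `[0,1]`. -/
structure Aut01 : Type where
  toEquiv : unitInterval ≃ unitInterval
  measurePreserving_toFun :
    MeasurePreserving toEquiv (volume : Measure unitInterval) volume
  measurePreserving_invFun :
    MeasurePreserving toEquiv.symm (volume : Measure unitInterval) volume

namespace Aut01

/-- The correlation `μ(A ∩ T^{-m} B)` (as a real number). -/
def corr (T : Aut01) (m : ℤ) (A B : Set unitInterval) : ℝ :=
  (volume (A ∩ ⇑(T.toEquiv ^ m : Equiv.Perm unitInterval) ⁻¹' B)).toReal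

/-- The dyadic interval `[k/2^ℓ, (k+1)/2^ℓ)` of rank `ℓ`, as a subset of `[0,1]`. -/
def dyadic (ℓ k : ℕ) : Set unitInterval :=
  {x | (k : ℝ) / 2 ^ ℓ ≤ (x : ℝ) ∧ (x : ℝ) < ((k : ℝ) + 1) / 2 ^ ℓ}

/-- The metric `∂(T,S) = Σ_{ℓ≥1} 2^{-2ℓ} Σ_{E of rank ℓ} μ(TE △ SE)` inducing the weak
topology on `Aut01`. -/
def wDist (T S : Aut01) : ℝ :=
  ∑' ℓ : ℕ,
    (1 / 2 ^ (2 * (ℓ + 1)) : ℝ) *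
      ∑ k ∈ Finset.range (2 ^ (ℓ + 1)),
        (volume (symmDiff (T.toEquiv '' dyadic (ℓ + 1) k) (S.toEquiv '' dyadic (ℓ + 1) k))).toReal

/-- The weak topology on `Aut01`, generated by the balls of the metric `wDist`. -/
instance : TopologicalSpace Aut01 :=
  TopologicalSpace.generateFrom
    {U | ∃ (T : Aut01) (ε : ℝ), 0 < ε ∧ U = {S | wDist T S < ε}}

/-- `T` is aperiodic: the set of periodic points has measure zero. -/
def Aperiodic (T : Aut01) : Prop :=
  volume {x : unitInterval |
    ∃ n : ℕ, 0 < n ∧ (T.toEquiv ^ n : Equiv.Perm unitInterval) x = x} = 0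

/-- `T` is weakly mixing. -/
def WeaklyMixing (T : Aut01) : Prop :=
  ∀ A B : Set unitInterval, MeasurableSet A → MeasurableSet B →
    Tendsto
      (fun M : ℕ =>
        (1 / (M : ℝ)) *
          ∑ n ∈ Finset.Icc 1 M,
            |T.corr (n : ℤ) A B - (volume A).toReal * (volume B).toReal|)
      atTop (𝓝 0)

end Aut01

section StandardProbabilitySpace
open Set

theorem exists_null_not_countable {X : Type*} [MeasurableSpace X] [StandardBorelSpace X]
    (hX : ¬ Countable X) (μ : Measure X) [SFinite μ] :
    ∃ N : Set X, MeasurableSet N ∧ μ N = 0 ∧ ¬ N.Countable := by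
  have hRR : ¬ Countable (ℝ × ℝ) := fun h =>
    not_countable_iff.2 inferInstance (Function.Injective.countable (f := fun x : ℝ => (x, x))
      fun a b h => (Prod.ext_iff.1 h).1)
  let e : X ≃ᵐ ℝ × ℝ := PolishSpace.measurableEquivOfNotCountable hX hRR
  let A : ℝ → Set X := fun a => (fun x => (e x).1) ⁻¹' {a}
  have hA : ∀ a, MeasurableSet (A a) := fun a =>
    (measurable_fst.comp e.measurable) (measurableSet_singleton a)
  have hc := Measure.countable_meas_pos_of_disjoint_iUnion (μ := μ) hA (by
    intro a b hab
    refine Set.disjoint_left.2 fun x hx hy => hab ?_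
    exact (show (e x).1 = a from hx).symm.trans hy)
  obtain ⟨a, ha⟩ : ∃ a, a ∉ {i | 0 < μ (A i)} := by
    by_contra! h
    exact not_countable_univ (hc.mono fun a _ => h a)
  refine ⟨A a, hA a, by simpa using ha, fun h => ?_⟩
  have : (Set.univ : Set ℝ).Countable := by
    refine (h.preimage_of_injOn (f := fun t : ℝ => e.symm (a, t)) ?_).mono ?_
    · intro s _ t _ hst
      have := e.symm.injective hst
      exact (Prod.ext_iff.1 this).2
    · intro t _
      simp [A]
  exact not_countable_univ this

/-- A measure-preserving map that is injective on a conull set agrees almost everywhere with a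
measurable equivalence. -/
theorem exists_measurableEquiv_ae_eq {X Y : Type*} [MeasurableSpace X] [StandardBorelSpace X]
    [MeasurableSpace Y] [StandardBorelSpace Y] (hX : ¬ Countable X) (hY : ¬ Countable Y)
    {μ : Measure X} {ν : Measure Y} [IsFiniteMeasure μ] [IsFiniteMeasure ν] {f : X → Y}
    (hf : MeasurePreserving f μ ν) {X₀ : Set X} (hX₀ : MeasurableSet X₀) (hnull : μ X₀ᶜ = 0)
    (hinj : InjOn f X₀) :
    ∃ e : X ≃ᵐ Y, MeasurePreserving e μ ν ∧ ∀ᵐ x ∂μ, e x = f x := by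
  classical
  obtain ⟨N, hN, hN0, hNc⟩ := exists_null_not_countable hX μ
  obtain ⟨M, hM, hM0, hMc⟩ := exists_null_not_countable hY ν
  let X₁ : Set X := X₀ \ (N ∪ f ⁻¹' M)
  have hX₁ : MeasurableSet X₁ := hX₀.diff (hN.union (hf.measurable hM))
  have hinj₁ : InjOn f X₁ := hinj.mono sdiff_subset
  have hY₁ : MeasurableSet (f '' X₁) := hX₁.image_of_measurable_injOn hf.measurable hinj₁
  have hX₁0 : μ X₁ᶜ = 0 := by
    have : X₁ᶜ ⊆ X₀ᶜ ∪ (N ∪ f ⁻¹' M) := by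
      intro x hx
      by_contra! h
      simp only [mem_union, not_or] at h
      exact hx ⟨not_not.1 h.1, by simpa using h.2⟩
    refine measure_mono_null this ?_
    simp [hnull, hN0, hf.measure_preimage hM.nullMeasurableSet, hM0]
  let g : X₁ → Y := X₁.domRestrict f
  have : StandardBorelSpace X₁ := hX₁.standardBorel
  have hg : MeasurableEmbedding g :=
    (hf.measurable.comp measurable_subtype_coe).measurableEmbedding (injOn_iff_injective.1 hinj₁)
  have hrange : range g = f '' X₁ := range_domRestrict f X₁
  have hR : MeasurableSet (range g) := hg.measurableSet_range
  have : StandardBorelSpace ↑(X₁ᶜ) := hX₁.compl.standardBorel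
  have : StandardBorelSpace ↑((range g)ᶜ) := hR.compl.standardBorel
  have h1 : ¬ Countable ↑(X₁ᶜ) := fun h => hNc ((countable_coe_iff.1 h).mono (by
    intro x hx hx'
    exact hx'.2 (Or.inl hx)))
  have h2 : ¬ Countable ↑((range g)ᶜ) := fun h => hMc ((countable_coe_iff.1 h).mono (by
    rw [hrange]
    rintro y hy ⟨x, hx, rfl⟩
    exact hx.2 (Or.inr hy)))
  let c := PolishSpace.measurableEquivOfNotCountable h1 h2
  let e : X ≃ᵐ Y := (MeasurableEquiv.sumCompl hX₁).symm.trans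
    ((MeasurableEquiv.sumCongr hg.equivRange c).trans (MeasurableEquiv.sumCompl hR))
  have he : ∀ x ∈ X₁, e x = f x := by
    intro x hx
    have : (MeasurableEquiv.sumCompl hX₁).symm x = Sum.inl ⟨x, hx⟩ := by
      rw [MeasurableEquiv.symm_apply_eq]; rfl
    change (MeasurableEquiv.sumCompl hR) ((MeasurableEquiv.sumCongr hg.equivRange c)
      ((MeasurableEquiv.sumCompl hX₁).symm x)) = f x
    rw [this]
    change ((hg.equivRange ⟨x, hx⟩ : range g) : Y) = f x
    rw [hg.equivRange_apply]
    rfl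
  have hae : ∀ᵐ x ∂μ, e x = f x := by
    filter_upwards [measure_eq_zero_iff_ae_notMem.1 hX₁0] with x hx
    exact he x (not_not.1 hx)
  refine ⟨e, ⟨e.measurable, ?_⟩, hae⟩
  rw [Measure.map_congr hae, hf.map_eq]

theorem not_countable_of_measure_univ_ne_zero {X : Type*} [MeasurableSpace X] {μ : Measure X}
    [NullSingletonClass μ] (h : μ univ ≠ 0) : ¬ Countable X := fun hc =>
  h (Set.Countable.measure_zero (countable_univ_iff.2 hc) μ)

theorem exists_measurePreserving_real_unitInterval (ν : Measure ℝ) [IsProbabilityMeasure ν]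
    [NullSingletonClass ν] :
    ∃ e : ℝ ≃ᵐ unitInterval, MeasurePreserving e ν volume := by
  let F : ℝ → unitInterval := fun x => ⟨ProbabilityTheory.cdf ν x,
    ProbabilityTheory.cdf_nonneg ν x, ProbabilityTheory.cdf_le_one ν x⟩
  have hmono : Monotone F := fun a b h => ProbabilityTheory.monotone_cdf ν h
  have hF : Measurable F := hmono.measurable
  have hcont : Continuous (ProbabilityTheory.cdf ν) := by
    refine continuous_iff_continuousAt.2 fun x => ?_
    rw [(ProbabilityTheory.cdf ν).mono.continuousAt_iff_leftLim_eq_rightLim,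
      (ProbabilityTheory.cdf ν).rightLim_eq]
    have h := (ProbabilityTheory.cdf ν).measure_singleton x
    rw [ProbabilityTheory.measure_cdf, measure_singleton] at h
    have h' := ENNReal.ofReal_eq_zero.1 h.symm
    exact le_antisymm ((ProbabilityTheory.cdf ν).mono.leftLim_le le_rfl) (by linarith)
  have hivt : ∀ a : ℝ, 0 < a → a < 1 → ∃ c, ProbabilityTheory.cdf ν c = a := by
    intro a h0 h1
    obtain ⟨x, hx⟩ := ((ProbabilityTheory.tendsto_cdf_atBot ν).eventually_lt_const h0).exists
    obtain ⟨y, hy⟩ := ((ProbabilityTheory.tendsto_cdf_atTop ν).eventually_const_lt h1).exists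
    exact mem_range_of_exists_le_of_exists_ge hcont ⟨x, hx.le⟩ ⟨y, hy.le⟩
  have hmap : Measure.map F ν = volume := by
    have := Measure.isProbabilityMeasure_map (μ := ν) hF.aemeasurable
    refine Measure.ext_of_Iic _ _ fun a => ?_
    rw [Measure.map_apply hF measurableSet_Iic, unitInterval.volume_Iic]
    refine le_antisymm ?_ ?_
    · refine le_of_forall_gt_imp_ge_of_dense fun b hb => ?_
      by_cases hb1 : 1 ≤ b
      · exact prob_le_one.trans hb1
      push Not at hb1
      obtain ⟨b, rfl⟩ : ∃ b' : ℝ, ENNReal.ofReal b' = b :=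
        ⟨b.toReal, ENNReal.ofReal_toReal (hb1.trans ENNReal.one_lt_top).ne⟩
      have hb' : (a : ℝ) < b := (ENNReal.ofReal_lt_ofReal_iff_of_nonneg a.2.1).1 hb
      have hb1' : b < 1 := by
        rwa [ENNReal.ofReal_lt_one] at hb1
      obtain ⟨c, hc⟩ := hivt b (lt_of_le_of_lt a.2.1 hb') hb1'
      rw [← hc, ProbabilityTheory.ofReal_cdf]
      refine measure_mono fun x hx => ?_
      by_contra hcx
      have h1 : ProbabilityTheory.cdf ν c ≤ ProbabilityTheory.cdf ν x :=
        ProbabilityTheory.monotone_cdf ν (not_le.1 hcx).le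
      have h2 : ProbabilityTheory.cdf ν x ≤ (a : ℝ) := hx
      linarith
    · rcases a.2.1.eq_or_lt with h0 | h0
      · simp [← h0]
      rcases a.2.2.eq_or_lt with h1 | h1
      · have : F ⁻¹' Iic a = univ := by
          ext x
          simp only [mem_preimage, mem_Iic, mem_univ, iff_true]
          exact Subtype.coe_le_coe.1 (by rw [h1]; exact (F x).2.2)
        simp [this, h1]
      obtain ⟨c, hc⟩ := hivt a h0 h1
      rw [← hc, ProbabilityTheory.ofReal_cdf]
      refine measure_mono fun x hx => ?_
      have : ProbabilityTheory.cdf ν x ≤ ProbabilityTheory.cdf ν c :=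
        ProbabilityTheory.monotone_cdf ν hx
      rw [hc] at this
      exact this
  have hmp : MeasurePreserving F ν volume := ⟨hF, hmap⟩
  let N : Set ℝ := ⋃ q : ℚ, F ⁻¹' {F q}
  have hN : MeasurableSet N := MeasurableSet.iUnion fun q => hF (measurableSet_singleton _)
  have hN0 : ν N = 0 := measure_iUnion_null fun q => by
    rw [hmp.measure_preimage (measurableSet_singleton _).nullMeasurableSet, measure_singleton]
  have hinj : InjOn F Nᶜ := by
    have key : ∀ x ∈ Nᶜ, ∀ y, F x = F y → ¬ x < y := by
      intro x hx y hxy hlt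
      obtain ⟨q, hq1, hq2⟩ := exists_rat_btwn hlt
      refine hx (mem_iUnion.2 ⟨q, ?_⟩)
      exact le_antisymm (hmono hq1.le) ((hmono hq2.le).trans hxy.ge)
    intro x hx y hy hxy
    exact le_antisymm (not_lt.1 (key y hy x hxy.symm)) (not_lt.1 (key x hx y hxy))
  obtain ⟨e, he, -⟩ := exists_measurableEquiv_ae_eq (not_countable_iff.2 inferInstance)
    (not_countable_of_measure_univ_ne_zero (μ := (volume : Measure unitInterval)) (by simp))
    hmp hN.compl (by simpa using hN0) hinj
  exact ⟨e, he⟩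

theorem exists_measurePreserving_unitInterval {X : Type*} [MeasurableSpace X]
    [StandardBorelSpace X] (μ : Measure X) [IsProbabilityMeasure μ] [NullSingletonClass μ] :
    ∃ e : X ≃ᵐ unitInterval, MeasurePreserving e μ volume := by
  have hX : ¬ Countable X := not_countable_of_measure_univ_ne_zero (μ := μ) (by simp)
  let c : X ≃ᵐ ℝ := PolishSpace.measurableEquivOfNotCountable hX
    (not_countable_iff.2 inferInstance)
  have := Measure.isProbabilityMeasure_map (μ := μ) c.measurable.aemeasurable
  have : NullSingletonClass (Measure.map c μ) := ⟨fun x => by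
    rw [c.map_apply, ← c.image_symm, image_singleton, measure_singleton]⟩
  obtain ⟨e, he⟩ := exists_measurePreserving_real_unitInterval (Measure.map c μ)
  exact ⟨c.trans e, he.comp ⟨c.measurable, rfl⟩⟩

/-- Two nontrivial finite atomless measures of the same mass on standard Borel spaces are
isomorphic. -/
theorem exists_measurePreserving_of_measure_univ_eq {X Y : Type*} [MeasurableSpace X]
    [StandardBorelSpace X] [MeasurableSpace Y] [StandardBorelSpace Y] (μ : Measure X)
    (ν : Measure Y) [IsFiniteMeasure μ] [IsFiniteMeasure ν] [NullSingletonClass μ]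
    [NullSingletonClass ν] (h0 : μ univ ≠ 0) (h : μ univ = ν univ) :
    ∃ e : X ≃ᵐ Y, MeasurePreserving e μ ν := by
  have hfin : μ univ ≠ ⊤ := measure_ne_top _ _
  have : NullSingletonClass ((μ univ)⁻¹ • μ) := ⟨fun x => by simp⟩
  have : NullSingletonClass ((μ univ)⁻¹ • ν) := ⟨fun x => by simp⟩
  have : IsProbabilityMeasure ((μ univ)⁻¹ • μ) := ⟨by
    simp [ENNReal.inv_mul_cancel h0 hfin]⟩
  have : IsProbabilityMeasure ((μ univ)⁻¹ • ν) := ⟨by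
    simp [← h, ENNReal.inv_mul_cancel h0 hfin]⟩
  obtain ⟨e, he⟩ := exists_measurePreserving_unitInterval ((μ univ)⁻¹ • μ)
  obtain ⟨e', he'⟩ := exists_measurePreserving_unitInterval ((μ univ)⁻¹ • ν)
  have hcomp := (he'.symm e').comp he
  refine ⟨e.trans e'.symm, (e.trans e'.symm).measurable, ?_⟩
  have h1 := hcomp.map_eq
  rw [Measure.map_smul] at h1
  have h2 := congrArg (fun ρ => (μ univ) • ρ) h1
  simp only [smul_smul, ENNReal.mul_inv_cancel h0 hfin, one_smul] at h2
  exact h2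

end StandardProbabilitySpace

section Gluing
open Set

/-- A measurable bijection between standard Borel spaces is a measurable equivalence. -/
theorem exists_measurableEquiv_of_bijective {X Y : Type*} [MeasurableSpace X]
    [StandardBorelSpace X] [MeasurableSpace Y] [StandardBorelSpace Y] {f : X → Y}
    (hf : Measurable f) (hb : Function.Bijective f) : ∃ e : X ≃ᵐ Y, ∀ x, e x = f x := by
  have he : MeasurableEmbedding f := hf.measurableEmbedding hb.1
  refine ⟨⟨Equiv.ofBijective f hb, hf, fun s hs => ?_⟩, fun x => rfl⟩
  rw [← Equiv.image_eq_preimage_symm]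
  exact he.measurableSet_image.2 hs

theorem measure_eq_tsum_inter_fiber {X ι : Type*} [MeasurableSpace X] [Countable ι]
    [MeasurableSpace ι] [MeasurableSingletonClass ι] (μ : Measure X) {i : X → ι}
    (hi : Measurable i) {s : Set X} (hs : MeasurableSet s) :
    μ s = ∑' a, μ (s ∩ i ⁻¹' {a}) := by
  rw [← measure_iUnion]
  · congr 1
    ext x
    simp
  · intro a b hab
    refine disjoint_left.2 fun x hx hy => hab ?_
    exact (show i x = a from hx.2).symm.trans hy.2
  · exact fun a => hs.inter (hi (measurableSet_singleton a))

theorem exists_measurePreserving_of_measure_fiber_eq {X Y ι : Type*} [MeasurableSpace X]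
    [StandardBorelSpace X] [MeasurableSpace Y] [StandardBorelSpace Y] (μ : Measure X)
    (ν : Measure Y) [IsFiniteMeasure μ] [IsFiniteMeasure ν] [NullSingletonClass μ]
    [NullSingletonClass ν] [Countable ι] [MeasurableSpace ι] [MeasurableSingletonClass ι]
    {i : X → ι} {j : Y → ι} (hi : Measurable i) (hj : Measurable j)
    (h : ∀ a, μ (i ⁻¹' {a}) = ν (j ⁻¹' {a}))
    (hne : ∀ a, μ (i ⁻¹' {a}) ≠ 0 ∨ (i ⁻¹' {a} = ∅ ∧ j ⁻¹' {a} = ∅)) :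
    ∃ e : X ≃ᵐ Y, MeasurePreserving e μ ν ∧ ∀ x, j (e x) = i x := by
  have hmi : ∀ a, MeasurableSet (i ⁻¹' {a}) := fun a => hi (measurableSet_singleton a)
  have hmj : ∀ a, MeasurableSet (j ⁻¹' {a}) := fun a => hj (measurableSet_singleton a)
  have hex : ∀ a, ∃ e : ↥(i ⁻¹' {a}) ≃ᵐ ↥(j ⁻¹' {a}),
      MeasurePreserving e (μ.comap (↑)) (ν.comap (↑)) := by
    intro a
    rcases hne a with h0 | ⟨h1, h2⟩
    · have := (hmi a).standardBorel
      have := (hmj a).standardBorel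
      have hX : NullSingletonClass (μ.comap ((↑) : ↥(i ⁻¹' {a}) → X)) := ⟨fun x => by
        rw [comap_subtype_coe_apply (hmi a), image_singleton, measure_singleton]⟩
      have hY : NullSingletonClass (ν.comap ((↑) : ↥(j ⁻¹' {a}) → Y)) := ⟨fun x => by
        rw [comap_subtype_coe_apply (hmj a), image_singleton, measure_singleton]⟩
      apply exists_measurePreserving_of_measure_univ_eq
      · rw [comap_subtype_coe_apply (hmi a)]
        rwa [image_univ, Subtype.range_coe]
      · rw [comap_subtype_coe_apply (hmi a), comap_subtype_coe_apply (hmj a)]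
        rw [image_univ, image_univ, Subtype.range_coe, Subtype.range_coe, h a]
    · have e1 : IsEmpty ↥(i ⁻¹' {a}) := by rw [h1]; infer_instance
      have e2 : IsEmpty ↥(j ⁻¹' {a}) := by rw [h2]; infer_instance
      refine ⟨⟨Equiv.equivOfIsEmpty _ _, measurable_of_empty _, measurable_of_empty _⟩,
        measurable_of_empty _, ?_⟩
      exact Subsingleton.elim _ _
  choose e he using hex
  let f : X → Y := fun x => (e (i x) ⟨x, rfl⟩ : Y)
  have hfe : ∀ a (x : X) (hx : i x = a), f x = (e a ⟨x, hx⟩ : Y) := by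
    rintro a x rfl; rfl
  have hjf : ∀ x, j (f x) = i x := fun x => (e (i x) ⟨x, rfl⟩).2
  have hset : ∀ (s : Set Y) a, f ⁻¹' s ∩ i ⁻¹' {a} =
      (↑) '' ((e a) ⁻¹' (((↑) : ↥(j ⁻¹' {a}) → Y) ⁻¹' s)) := by
    intro s a
    ext x
    constructor
    · rintro ⟨h1, h2⟩
      refine ⟨⟨x, h2⟩, ?_, rfl⟩
      rw [mem_preimage, hfe a x h2] at h1
      exact h1
    · rintro ⟨⟨x, h2⟩, h1, rfl⟩
      refine ⟨?_, h2⟩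
      rw [mem_preimage, hfe a x h2]
      exact h1
  have hmeas : ∀ s, MeasurableSet s → ∀ a, MeasurableSet (f ⁻¹' s ∩ i ⁻¹' {a}) := by
    intro s hs a
    rw [hset]
    exact (hmi a).subtype_image ((e a).measurable (measurable_subtype_coe hs))
  have hf : Measurable f := by
    intro s hs
    have : f ⁻¹' s = ⋃ a, f ⁻¹' s ∩ i ⁻¹' {a} := by ext x; simp
    rw [this]
    exact MeasurableSet.iUnion fun a => hmeas s hs a
  have hbij : Function.Bijective f := by
    constructor
    · intro x y hxy
      have hi' : i x = i y := by rw [← hjf x, hxy, hjf y]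
      have h2 := hfe (i y) x hi'
      rw [hxy] at h2
      have h3 : (⟨y, rfl⟩ : ↥(i ⁻¹' {i y})) = ⟨x, hi'⟩ := (e (i y)).injective (Subtype.ext h2)
      exact (congrArg Subtype.val h3).symm
    · intro y
      let x := (e (j y)).symm ⟨y, rfl⟩
      refine ⟨x, ?_⟩
      rw [hfe (j y) x x.2]
      simp [x]
  obtain ⟨E, hE⟩ := exists_measurableEquiv_of_bijective hf hbij
  have hEf : (E : X → Y) = f := funext hE
  refine ⟨E, ⟨E.measurable, ?_⟩, fun x => by rw [hE, hjf]⟩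
  ext s hs
  rw [hEf, Measure.map_apply hf hs, measure_eq_tsum_inter_fiber μ hi (hf hs),
    measure_eq_tsum_inter_fiber ν hj hs]
  congr 1
  ext a
  rw [hset, ← comap_subtype_coe_apply (hmi a),
    (he a).measure_preimage (measurable_subtype_coe hs).nullMeasurableSet,
    comap_subtype_coe_apply (hmj a), Subtype.image_preimage_coe, inter_comm]

/-- For a countable partition `i` of an atomless standard probability space `X`, there is an
isomorphism of `X` with `X × [0,1]` whose first coordinate respects `i` almost everywhere, and
respects exactly any coarser partition `g ∘ i` without nonempty null cells. -/
theorem exists_measurePreserving_prod_unitInterval {X ι κ : Type*} [MeasurableSpace X]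
    [StandardBorelSpace X] (μ : Measure X) [IsProbabilityMeasure μ] [NullSingletonClass μ]
    [Countable ι] [MeasurableSpace ι] [DiscreteMeasurableSpace ι]
    {i : X → ι} (hi : Measurable i) (g : ι → κ)
    (hg : ∀ x, μ {y | g (i y) = g (i x)} ≠ 0) :
    ∃ e : X ≃ᵐ X × unitInterval, MeasurePreserving e μ (μ.prod volume) ∧
      (∀ᵐ x ∂μ, i (e x).1 = i x) ∧ ∀ x, g (i (e x).1) = g (i x) := by
  classical
  let f : ι → ι := fun a => if h : μ (i ⁻¹' {a}) = 0 ∧ ∃ b, g b = g a ∧ μ (i ⁻¹' {b}) ≠ 0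
    then h.2.choose else a
  have hgf : ∀ a, g (f a) = g a := by
    intro a
    by_cases h : μ (i ⁻¹' {a}) = 0 ∧ ∃ b, g b = g a ∧ μ (i ⁻¹' {b}) ≠ 0
    · simp only [f, dif_pos h]; exact h.2.choose_spec.1
    · simp only [f, dif_neg h]
  have hfid : ∀ a, μ (i ⁻¹' {a}) ≠ 0 → f a = a := fun a ha => by
    simp only [f]; rw [dif_neg]; exact fun h => ha h.1
  have hnn : ∀ x, μ (i ⁻¹' {f (i x)}) ≠ 0 := by
    intro x
    by_cases h0 : μ (i ⁻¹' {i x}) = 0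
    · have hex : ∃ b, g b = g (i x) ∧ μ (i ⁻¹' {b}) ≠ 0 := by
        by_contra! hcon
        refine hg x ?_
        have : {y | g (i y) = g (i x)} ⊆ ⋃ b : {b // g b = g (i x)}, i ⁻¹' {b.1} := by
          intro y hy
          exact mem_iUnion.2 ⟨⟨i y, hy⟩, rfl⟩
        exact measure_mono_null this (measure_iUnion_null fun b => hcon b.1 b.2)
      have h : μ (i ⁻¹' {i x}) = 0 ∧ ∃ b, g b = g (i x) ∧ μ (i ⁻¹' {b}) ≠ 0 := ⟨h0, hex⟩
      simp only [f, dif_pos h]; exact h.2.choose_spec.2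
    · rwa [hfid _ h0]
  have hfi : Measurable (fun x => f (i x)) := (Measurable.of_discrete (f := f)).comp hi
  have hae : ∀ᵐ x ∂μ, f (i x) = i x := by
    have : ∀ᵐ x ∂μ, ∀ a, μ (i ⁻¹' {a}) = 0 → x ∉ i ⁻¹' {a} := ae_all_iff.2 fun a => by
      by_cases h : μ (i ⁻¹' {a}) = 0
      · filter_upwards [measure_eq_zero_iff_ae_notMem.1 h] with x hx _ using hx
      · exact Eventually.of_forall fun x h' => absurd h' h
    filter_upwards [this] with x hx
    exact hfid _ fun h => hx _ h rfl
  obtain ⟨e, he, hei⟩ := exists_measurePreserving_of_measure_fiber_eq μ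
    (μ.prod (volume : Measure unitInterval)) (i := fun x => f (i x)) (j := fun p => f (i p.1))
    hfi (hfi.comp measurable_fst) (fun a => by
      have h1 :=
        (measurePreserving_fst (μ := μ) (ν := (volume : Measure unitInterval))).measure_preimage
        (hfi (measurableSet_singleton a)).nullMeasurableSet
      rw [← h1]; rfl) (fun a => by
      by_cases h : ∃ x, f (i x) = a
      · obtain ⟨x, rfl⟩ := h
        left
        refine fun h0 => hnn x (measure_mono_null ?_ h0)
        intro y hy
        have hy' : i y = f (i x) := hy
        change f (i y) = f (i x)
        rw [hy', hfid _ (hnn x)]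
      · push Not at h
        exact Or.inr ⟨eq_empty_of_forall_notMem h, eq_empty_of_forall_notMem fun p => h p.1⟩)
  refine ⟨e, he, ?_, fun x => ?_⟩
  · have hq := (measurePreserving_fst.comp he).quasiMeasurePreserving.ae hae
    filter_upwards [hae, hq] with x h1 h2
    rw [← h1, ← hei x]
    exact h2.symm
  · rw [← hgf, hei x, hgf]

end Gluing

section Dynamics
open Set

/-- A bijection preserving the measure `μ` in both directions. -/
structure IsAut {X : Type*} [MeasurableSpace X] (μ : Measure X) (T : Equiv.Perm X) : Prop where
  mp : MeasurePreserving T μ μ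
  mp_inv : MeasurePreserving ⇑T⁻¹ μ μ

namespace IsAut

variable {X : Type*} [MeasurableSpace X] {μ : Measure X} {T S : Equiv.Perm X}

theorem one : IsAut μ (1 : Equiv.Perm X) := ⟨MeasurePreserving.id μ, MeasurePreserving.id μ⟩

theorem inv (h : IsAut μ T) : IsAut μ T⁻¹ := ⟨h.mp_inv, h.mp⟩

theorem mul (h : IsAut μ T) (h' : IsAut μ S) : IsAut μ (T * S) :=
  ⟨h.mp.comp h'.mp, by rw [mul_inv_rev]; exact h'.mp_inv.comp h.mp_inv⟩

theorem pow (h : IsAut μ T) (k : ℕ) : IsAut μ (T ^ k) := by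
  induction k with
  | zero => simpa using one
  | succ k ih => rw [pow_succ]; exact ih.mul h

theorem zpow (h : IsAut μ T) (k : ℤ) : IsAut μ (T ^ k) := by
  cases k with
  | ofNat k => simpa using h.pow k
  | negSucc k => rw [zpow_negSucc]; exact (h.pow _).inv

end IsAut

/-- `h` is the height function of a tower with `n` levels for `T`; points off the tower get
height `n`. -/
structure IsTower {X : Type*} [MeasurableSpace X] (T : Equiv.Perm X) (n : ℕ) (h : X → ℕ) :
    Prop where
  measurable : Measurable h
  le : ∀ x, h x ≤ n
  succ_iff : ∀ x k, k + 1 < n → (h (T x) = k + 1 ↔ h x = k)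

namespace IsTower

variable {X : Type*} [MeasurableSpace X] {T : Equiv.Perm X} {n : ℕ} {h : X → ℕ}

theorem pow_iff (ht : IsTower T n h) (x : X) {k : ℕ} (hk : k < n) :
    h ((T ^ k) x) = k ↔ h x = 0 := by
  induction k with
  | zero => simp
  | succ k ih =>
    rw [pow_succ', Equiv.Perm.mul_apply, ht.succ_iff _ _ hk, ih (by omega)]

/-- The number of steps from the base of the tower to height `k`. -/
def lift (n k : ℕ) : ℕ := if k < n then k else 0

/-- The height at which the orbit segment through height `k` starts. -/
def base (n k : ℕ) : ℕ := if k < n then 0 else k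

theorem lift_iff (ht : IsTower T n h) (x : X) (k : ℕ) :
    h ((T ^ lift n k) x) = k ↔ h x = base n k := by
  by_cases hk : k < n
  · simpa [lift, base, hk] using ht.pow_iff x hk
  · simp [lift, base, hk]

theorem lift_inv_iff (ht : IsTower T n h) (x : X) (k : ℕ) :
    h ((T ^ lift n k)⁻¹ x) = base n k ↔ h x = k := by
  rw [← ht.lift_iff]; simp

theorem measure_fiber {μ : Measure X} (hT : IsAut μ T) (ht : IsTower T n h) {k : ℕ}
    (hk : k < n) : μ (h ⁻¹' {k}) = μ (h ⁻¹' {0}) := by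
  rw [← (hT.pow k).mp.measure_preimage
    (ht.measurable (measurableSet_singleton k)).nullMeasurableSet]
  congr 1
  ext x
  exact ht.pow_iff x hk

theorem measure_fiber_eq {μ : Measure X} [IsProbabilityMeasure μ] (hT : IsAut μ T)
    (ht : IsTower T n h) (hn : 0 < n) (h0 : μ (h ⁻¹' {0}) = ENNReal.ofReal (1 / (n + 1)))
    {k : ℕ} (hk : k ≤ n) :
    μ (h ⁻¹' {k}) = ENNReal.ofReal (1 / (n + 1)) := by
  rcases hk.lt_or_eq with hk | rfl
  · rw [ht.measure_fiber hT hk, h0]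
  have hm : ∀ a, MeasurableSet (h ⁻¹' {a}) := fun a => ht.measurable (measurableSet_singleton a)
  have hsum : μ.real (⋃ a ∈ Finset.range (k + 1), h ⁻¹' {a}) =
      ∑ a ∈ Finset.range (k + 1), μ.real (h ⁻¹' {a}) := by
    apply measureReal_biUnion_finset
    · intro a _ b _ hab
      refine disjoint_left.2 fun x hx hy => hab ?_
      exact (show h x = a from hx).symm.trans hy
    · exact fun a _ => hm a
    · exact fun a _ => measure_ne_top _ _
  have huniv : (⋃ a ∈ Finset.range (k + 1), h ⁻¹' {a}) = univ := by
    ext x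
    simpa [Nat.lt_succ_iff] using ht.le x
  have hpos : (0 : ℝ) < 1 / (k + 1) := by positivity
  rw [huniv, probReal_univ, Finset.sum_range_succ, Finset.sum_congr rfl (fun a ha => by
    rw [measureReal_def, ht.measure_fiber hT (Finset.mem_range.1 ha), h0,
      ENNReal.toReal_ofReal hpos.le])] at hsum
  rw [← ENNReal.ofReal_toReal (measure_ne_top μ (h ⁻¹' {k}))]
  congr 1
  simp only [Finset.sum_const, Finset.card_range, nsmul_eq_mul, measureReal_def] at hsum
  field_simp at hsum ⊢
  linarith

theorem measure_top_le {μ : Measure X} [IsProbabilityMeasure μ] (hT : IsAut μ T)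
    (ht : IsTower T n h) (hn : 0 < n) (h0 : μ (h ⁻¹' {0}) = ENNReal.ofReal (1 / (n + 1))) :
    μ {x | ¬ h x + 1 < n} ≤ ENNReal.ofReal (2 / (n + 1)) := by
  have hsub : {x | ¬ h x + 1 < n} ⊆ h ⁻¹' {n - 1} ∪ h ⁻¹' {n} := by
    intro x hx
    have := ht.le x
    simp only [mem_ofPred_eq, mem_union, mem_preimage, mem_singleton_iff] at hx ⊢
    omega
  refine (measure_mono hsub).trans ((measure_union_le _ _).trans ?_)
  rw [ht.measure_fiber_eq hT hn h0 (Nat.sub_le n 1), ht.measure_fiber_eq hT hn h0 le_rfl,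
    ← ENNReal.ofReal_add (by positivity) (by positivity)]
  refine ENNReal.ofReal_le_ofReal (le_of_eq ?_)
  ring

/-- An isomorphism respecting the heights of two towers can be modified so as to intertwine the
dynamics on the towers. -/
theorem exists_conj {Y : Type*} [MeasurableSpace Y] [StandardBorelSpace X] [StandardBorelSpace Y]
    {μ : Measure X} {ν : Measure Y} {R : Equiv.Perm Y} {h' : Y → ℕ} (hT : IsAut μ T)
    (hR : IsAut ν R) (ht : IsTower T n h) (ht' : IsTower R n h') (e : X ≃ᵐ Y)
    (he : MeasurePreserving e μ ν) (heh : ∀ x, h' (e x) = h x) :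
    ∃ θ : X ≃ᵐ Y, MeasurePreserving θ μ ν ∧
      (∀ x, θ x = (R ^ lift n (h x)) (e ((T ^ lift n (h x))⁻¹ x))) ∧
      ∀ x, h x + 1 < n → θ (T x) = R (θ x) := by
  let G : ℕ → X → Y := fun k x => (R ^ lift n k) (e ((T ^ lift n k)⁻¹ x))
  have hG : ∀ k, MeasurePreserving (G k) μ ν := fun k =>
    (hR.pow _).mp.comp (he.comp (hT.pow _).mp_inv)
  have hGh : ∀ k x, h' (G k x) = k ↔ h x = k := by
    intro k x
    rw [ht'.lift_iff, heh, ht.lift_inv_iff]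
  let f : X → Y := fun x => G (h x) x
  have hf : Measurable f :=
    (measurable_from_prod_countable_right (f := fun p : ℕ × X => G p.1 p.2)
      fun k => (hG k).measurable).comp (ht.measurable.prodMk measurable_id)
  have hfh : ∀ x, h' (f x) = h x := fun x => (hGh (h x) x).2 rfl
  have hGinj : ∀ k, Function.Bijective (G k) := fun k =>
    (R ^ lift n k).bijective.comp (e.bijective.comp (T ^ lift n k)⁻¹.bijective)
  have hbij : Function.Bijective f := by
    constructor
    · intro x y hxy
      have hh : h x = h y := by rw [← hfh x, hxy, hfh y]
      simp only [f, hh] at hxy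
      exact (hGinj _).1 hxy
    · intro y
      obtain ⟨x, hx⟩ := (hGinj (h' y)).2 y
      refine ⟨x, ?_⟩
      have : h x = h' y := (hGh _ x).1 (by rw [hx])
      simp only [f, this, hx]
  obtain ⟨θ, hθ⟩ := exists_measurableEquiv_of_bijective hf hbij
  have hθf : (θ : X → Y) = f := funext hθ
  refine ⟨θ, ⟨θ.measurable, ?_⟩, hθ, fun x hx => ?_⟩
  · ext s hs
    rw [hθf, Measure.map_apply hf hs, measure_eq_tsum_inter_fiber μ ht.measurable (hf hs),
      measure_eq_tsum_inter_fiber ν ht'.measurable hs]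
    congr 1
    ext k
    rw [← (hG k).measure_preimage
      (hs.inter (ht'.measurable (measurableSet_singleton k))).nullMeasurableSet]
    congr 1
    ext x
    simp only [mem_inter_iff, mem_preimage, mem_singleton_iff, hGh, f]
    constructor
    · rintro ⟨h1, rfl⟩; exact ⟨h1, rfl⟩
    · rintro ⟨h1, rfl⟩; exact ⟨h1, rfl⟩
  · have h1 : h (T x) = h x + 1 := (ht.succ_iff x _ hx).2 rfl
    have h2 : h x < n := by omega
    rw [hθ, hθ]
    simp only [f, G, h1, lift, hx, h2, if_true]
    rw [pow_succ' R, Equiv.Perm.mul_apply, pow_succ T, mul_inv_rev, Equiv.Perm.mul_apply]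
    congr 3
    rw [← Equiv.Perm.mul_apply, ← Equiv.Perm.mul_apply]
    congr 1
    group

end IsTower

end Dynamics

section Rokhlin
open Set

/-- The periodic points of `T` form a null set. -/
def IsAper {X : Type*} [MeasurableSpace X] (μ : Measure X) (T : Equiv.Perm X) : Prop :=
  μ {x | ∃ n : ℕ, 0 < n ∧ (T ^ n) x = x} = 0

theorem IsAper.exists_cover {X : Type*} [MetricSpace X] [TopologicalSpace.SeparableSpace X]
    [MeasurableSpace X] [BorelSpace X] {μ : Measure X} {T : Equiv.Perm X} [Nonempty X]
    (hT : IsAut μ T) (ha : IsAper μ T) (m : ℕ) :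
    ∃ A : ℕ → Set X, (∀ i, MeasurableSet (A i)) ∧ (∀ᵐ x ∂μ, ∃ i, x ∈ A i) ∧
      ∀ i, ∀ x ∈ A i, ∀ k, 1 ≤ k → k < m → (T ^ k) x ∉ A i := by
  have : SecondCountableTopology X := UniformSpace.secondCountable_of_separable X
  let q := TopologicalSpace.denseSeq X
  let A' : ℕ × ℕ → Set X := fun p => {y | dist y (q p.1) < 1 / ((p.2 : ℝ) + 1) ∧
    ∀ k ∈ Finset.Ico 1 m, 2 / ((p.2 : ℝ) + 1) ≤ dist ((T ^ k) y) y}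
  have hA' : ∀ p, MeasurableSet (A' p) := by
    intro p
    refine (measurableSet_lt (measurable_id.dist measurable_const) measurable_const).inter
      (s₂ := {y | ∀ k ∈ Finset.Ico 1 m, 2 / ((p.2 : ℝ) + 1) ≤ dist ((T ^ k) y) y}) ?_
    have : {y | ∀ k ∈ Finset.Ico 1 m, 2 / ((p.2 : ℝ) + 1) ≤ dist ((T ^ k) y) y} =
        ⋂ k ∈ Finset.Ico 1 m, {y | 2 / ((p.2 : ℝ) + 1) ≤ dist ((T ^ k) y) y} := by
      ext; simp
    rw [this]
    exact Finset.measurableSet_biInter _ fun k _ =>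
      measurableSet_le measurable_const ((hT.pow k).mp.measurable.dist measurable_id)
  refine ⟨fun i => A' i.unpair, fun i => hA' _, ?_, ?_⟩
  · filter_upwards [measure_eq_zero_iff_ae_notMem.1 ha] with x hx
    have hpos : ∀ k ∈ Finset.Ico 1 m, ∀ᶠ N : ℕ in atTop,
        2 / ((N : ℝ) + 1) ≤ dist ((T ^ k) x) x := by
      intro k hk
      have hd : 0 < dist ((T ^ k) x) x := dist_pos.2 fun h =>
        hx ⟨k, (Finset.mem_Ico.1 hk).1, h⟩
      have ht : Tendsto (fun N : ℕ => 2 * (1 / ((N : ℝ) + 1))) atTop (𝓝 (2 * 0)) :=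
        tendsto_one_div_add_atTop_nhds_zero_nat.const_mul 2
      rw [mul_zero] at ht
      filter_upwards [ht.eventually_lt_const hd] with N hN
      rw [div_eq_mul_one_div]
      exact hN.le
    obtain ⟨N, hN⟩ := ((Finset.eventually_all _).2 hpos).exists
    obtain ⟨j, hj⟩ := (TopologicalSpace.denseRange_denseSeq X).exists_dist_lt x
      (ε := 1 / ((N : ℝ) + 1)) (by positivity)
    refine ⟨Nat.pair j N, ?_⟩
    rw [Nat.unpair_pair]
    exact ⟨hj, hN⟩
  · intro i x hx k hk1 hkm hkx
    have h1 := hx.2 k (Finset.mem_Ico.2 ⟨hk1, hkm⟩)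
    have h2 := dist_triangle_right ((T ^ k) x) x (q i.unpair.1)
    have h3 := hx.1
    have h4 := hkx.1
    have : 2 / (((i.unpair.2 : ℕ) : ℝ) + 1) =
        1 / (((i.unpair.2 : ℕ) : ℝ) + 1) + 1 / (((i.unpair.2 : ℕ) : ℝ) + 1) := by ring
    linarith

theorem IsAper.exists_marker {X : Type*} [MetricSpace X] [TopologicalSpace.SeparableSpace X]
    [MeasurableSpace X] [BorelSpace X] {μ : Measure X} {T : Equiv.Perm X} [Nonempty X]
    (hT : IsAut μ T) (ha : IsAper μ T) (m : ℕ) :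
    ∃ B : Set X, MeasurableSet B ∧ (∀ x ∈ B, ∀ k, 1 ≤ k → k < m → (T ^ k) x ∉ B) ∧
      ∀ᵐ x ∂μ, ∃ k : ℕ, (T ^ k) x ∈ B := by
  obtain ⟨A, hA, hcov, hsep⟩ := ha.exists_cover hT m
  let B : ℕ → Set X := fun i => Nat.rec ∅ (fun i Bi =>
    Bi ∪ {x | x ∈ A i ∧ ∀ k < m, (T ^ k) x ∉ Bi ∧ (T ^ k)⁻¹ x ∉ Bi}) i
  have hBs : ∀ i, B (i + 1) =
    B i ∪ {x | x ∈ A i ∧ ∀ k < m, (T ^ k) x ∉ B i ∧ (T ^ k)⁻¹ x ∉ B i} := fun i => rfl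
  have hBm : ∀ i, MeasurableSet (B i) := by
    intro i
    induction i with
    | zero => exact MeasurableSet.empty
    | succ i ih =>
      rw [hBs]
      have hset : {x | ∀ k < m, (T ^ k) x ∉ B i ∧ (T ^ k)⁻¹ x ∉ B i} =
          ⋂ k, ⋂ (_ : k < m), (⇑(T ^ k) ⁻¹' (B i))ᶜ ∩ (⇑(T ^ k)⁻¹ ⁻¹' (B i))ᶜ := by
        ext x; simp
      refine ih.union ((hA i).inter (s₂ := {x | ∀ k < m, (T ^ k) x ∉ B i ∧ (T ^ k)⁻¹ x ∉ B i}) ?_)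
      rw [hset]
      exact MeasurableSet.iInter fun k => MeasurableSet.iInter fun _ =>
        ((hT.pow k).mp.measurable ih).compl.inter ((hT.pow k).mp_inv.measurable ih).compl
  have hmono : Monotone B := monotone_nat_of_le_succ fun i => by
    rw [hBs]; exact subset_union_left
  have hdisj : ∀ i, ∀ x ∈ B i, ∀ k, 1 ≤ k → k < m → (T ^ k) x ∉ B i := by
    intro i
    induction i with
    | zero => intro x hx; exact absurd hx (notMem_empty x)
    | succ i ih =>
      intro x hx k hk1 hkm hkx
      rw [hBs] at hx hkx
      rcases hx with hx | hx
      · rcases hkx with hkx | hkx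
        · exact ih x hx k hk1 hkm hkx
        · exact (hkx.2 k hkm).2 (by simpa using hx)
      · rcases hkx with hkx | hkx
        · exact (hx.2 k hkm).1 hkx
        · exact hsep i x hx.1 k hk1 hkm hkx.1
  refine ⟨⋃ i, B i, MeasurableSet.iUnion hBm, ?_, ?_⟩
  · intro x hx k hk1 hkm hkx
    obtain ⟨i, hi⟩ := mem_iUnion.1 hx
    obtain ⟨j, hj⟩ := mem_iUnion.1 hkx
    exact hdisj (max i j) x (hmono (le_max_left _ _) hi) k hk1 hkm (hmono (le_max_right _ _) hj)
  · have hcov' := (hT.pow m).mp.quasiMeasurePreserving.ae hcov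
    filter_upwards [hcov'] with x hx
    obtain ⟨i, hi⟩ := hx
    rcases Classical.em ((T ^ m) x ∈ B (i + 1)) with h | h
    · exact ⟨m, mem_iUnion.2 ⟨i + 1, h⟩⟩
    · rw [hBs] at h
      obtain ⟨k, hk, h⟩ : ∃ k < m, (T ^ k) ((T ^ m) x) ∉ B i → (T ^ k)⁻¹ ((T ^ m) x) ∈ B i := by
        by_contra! hc
        exact h (Or.inr ⟨hi, hc⟩)
      rcases Classical.em ((T ^ k) ((T ^ m) x) ∈ B i) with h' | h'
      · refine ⟨k + m, mem_iUnion.2 ⟨i, ?_⟩⟩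
        rwa [pow_add]
      · refine ⟨m - k, mem_iUnion.2 ⟨i, ?_⟩⟩
        have := h h'
        rwa [← Equiv.Perm.mul_apply, ← zpow_natCast, ← zpow_natCast, ← zpow_neg, ← zpow_add,
          show -(k : ℤ) + m = ((m - k : ℕ) : ℤ) by push_cast [hk.le]; ring, zpow_natCast] at this

theorem exists_measurable_subset_measure_eq {X : Type*} [MeasurableSpace X]
    [StandardBorelSpace X] {μ : Measure X} [IsFiniteMeasure μ] [NullSingletonClass μ]
    {E : Set X} (hE : MeasurableSet E) {b : ℝ} (hb0 : 0 ≤ b) (hb : b ≤ μ.real E) :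
    ∃ E' ⊆ E, MeasurableSet E' ∧ μ E' = ENNReal.ofReal b := by
  rcases hb0.eq_or_lt with rfl | hb0
  · exact ⟨∅, empty_subset _, MeasurableSet.empty, by simp⟩
  have hr : 0 < μ.real E := hb0.trans_le hb
  have h0 : μ E ≠ 0 := fun h => by simp [measureReal_def, h] at hr
  have hfin : μ E ≠ ⊤ := measure_ne_top _ _
  have : NullSingletonClass ((μ E)⁻¹ • μ.restrict E) := ⟨fun x => by simp⟩
  have : IsProbabilityMeasure ((μ E)⁻¹ • μ.restrict E) :=
    ⟨by simp [ENNReal.inv_mul_cancel h0 hfin]⟩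
  obtain ⟨e, he⟩ := exists_measurePreserving_unitInterval ((μ E)⁻¹ • μ.restrict E)
  let t : unitInterval := ⟨b / μ.real E, by positivity, (div_le_one hr).2 hb⟩
  refine ⟨e ⁻¹' (Iic t) ∩ E, inter_subset_right, (e.measurable measurableSet_Iic).inter hE, ?_⟩
  have h1 := he.measure_preimage (measurableSet_Iic (a := t)).nullMeasurableSet
  rw [unitInterval.volume_Iic, Measure.smul_apply,
    Measure.restrict_apply (e.measurable measurableSet_Iic), smul_eq_mul] at h1
  have h2 := congrArg (fun z => μ E * z) h1
  simp only [← mul_assoc, ENNReal.mul_inv_cancel h0 hfin, one_mul] at h2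
  rw [h2, ← ENNReal.ofReal_toReal hfin, ← ENNReal.ofReal_mul ENNReal.toReal_nonneg]
  congr 1
  simp only [t, ← measureReal_def]
  field_simp

/-- Rokhlin's lemma, with a tower all of whose levels, as well as the complement, have the same
measure. -/
theorem IsAper.exists_isTower {X : Type*} [MetricSpace X] [TopologicalSpace.SeparableSpace X]
    [MeasurableSpace X] [BorelSpace X] [StandardBorelSpace X] {μ : Measure X}
    {T : Equiv.Perm X} [Nonempty X] [IsProbabilityMeasure μ] [NullSingletonClass μ]
    (hT : IsAut μ T) (ha : IsAper μ T) {n : ℕ} (hn : 0 < n) :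
    ∃ h : X → ℕ, IsTower T n h ∧ μ (h ⁻¹' {0}) = ENNReal.ofReal (1 / (n + 1)) := by
  classical
  obtain ⟨B, hB, hBdisj, hBcov⟩ := ha.exists_marker hT (n * (n + 1))
  let E : Set X := {x | ∃ q : ℕ, (T ^ (q * n + (n - 1))) x ∈ B ∧
    ∀ k < q * n + (n - 1), (T ^ k) x ∉ B}
  have hE : MeasurableSet E := by
    have : E = ⋃ q : ℕ, (⇑(T ^ (q * n + (n - 1))) ⁻¹' B) ∩
        ⋂ k, ⋂ (_ : k < q * n + (n - 1)), (⇑(T ^ k) ⁻¹' B)ᶜ := by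
      ext x; simp [E]
    rw [this]
    exact MeasurableSet.iUnion fun q => ((hT.pow _).mp.measurable hB).inter
      (MeasurableSet.iInter fun k => MeasurableSet.iInter fun _ =>
        ((hT.pow k).mp.measurable hB).compl)
  have hEdisj : ∀ x ∈ E, ∀ j, 1 ≤ j → j < n → (T ^ j) x ∉ E := by
    rintro x ⟨q, hq, hq'⟩ j hj1 hjn ⟨r, hr, hr'⟩
    have e1 : q * n + (n - 1) ≤ r * n + (n - 1) + j := by
      by_contra! hlt
      refine hq' _ hlt ?_
      rwa [pow_add]
    have e2 : r * n + (n - 1) ≤ q * n + (n - 1) - j := by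
      by_contra! hlt
      refine hr' _ hlt ?_
      rw [← Equiv.Perm.mul_apply, ← pow_add, Nat.sub_add_cancel (by omega)]
      exact hq
    have e3 : q * n = r * n + j := by omega
    have : n ∣ j := (Nat.dvd_add_right (Dvd.intro_left r rfl)).1 (e3 ▸ Dvd.intro_left q rfl)
    exact absurd (Nat.le_of_dvd (by omega) this) (by omega)
  have hcover : ∀ᵐ x ∂μ, x ∈ (⋃ k ∈ Finset.range n, ⇑(T ^ k)⁻¹ ⁻¹' E) ∪
      ⋃ k ∈ Finset.range n, ⇑(T ^ k)⁻¹ ⁻¹' B := by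
    filter_upwards [hBcov] with y hy
    by_cases hyB : ∃ k < n, (T ^ k)⁻¹ y ∈ B
    · obtain ⟨k, hk, h⟩ := hyB
      exact Or.inr (mem_biUnion (Finset.mem_coe.2 (Finset.mem_range.2 hk)) h)
    push Not at hyB
    left
    have hs := Nat.find_spec hy
    have hmin := fun k (hk : k < Nat.find hy) => Nat.find_min hy hk
    set s := Nat.find hy
    have hmod := Nat.mod_lt s hn
    set i := n - 1 - s % n with hi
    have hin : i < n := by omega
    have hsi : s / n * n + (n - 1) = s + i := by
      have := Nat.div_add_mod s n
      rw [mul_comm] at this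
      omega
    refine mem_biUnion (Finset.mem_coe.2 (Finset.mem_range.2 hin)) ⟨s / n, ?_, ?_⟩
    · rw [hsi, pow_add]
      simpa using hs
    · intro k hk
      rw [hsi] at hk
      by_cases hki : k < i
      · have := hyB (i - k) (by omega)
        have e : (T ^ k) ((T ^ i)⁻¹ y) = (T ^ (i - k))⁻¹ y := by
          rw [← Equiv.Perm.mul_apply, ← zpow_natCast, ← zpow_natCast, ← zpow_natCast, ← zpow_neg,
            ← zpow_neg, ← zpow_add, show (k : ℤ) + -i = -((i - k : ℕ) : ℤ) by
              push_cast [hki.le]; ring]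
        rwa [e]
      · have := hmin (k - i) (by omega)
        have e : (T ^ k) ((T ^ i)⁻¹ y) = (T ^ (k - i)) y := by
          rw [← Equiv.Perm.mul_apply, ← zpow_natCast, ← zpow_natCast, ← zpow_natCast, ← zpow_neg,
            ← zpow_add, show (k : ℤ) + -i = ((k - i : ℕ) : ℤ) by
              push_cast [not_lt.1 hki]; ring]
        rwa [e]
  have hBsmall : (n * (n + 1) : ℝ) * μ.real B ≤ 1 := by
    have h1 : μ.real (⋃ k ∈ Finset.range (n * (n + 1)), ⇑(T ^ k) ⁻¹' B) =
        ∑ k ∈ Finset.range (n * (n + 1)), μ.real (⇑(T ^ k) ⁻¹' B) := by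
      apply measureReal_biUnion_finset
      · have key : ∀ k l, k < l → l < n * (n + 1) → ∀ x, (T ^ k) x ∈ B → (T ^ l) x ∉ B := by
          intro k l hkl hl x hk
          have := hBdisj _ hk (l - k) (by omega) (by omega)
          rwa [← Equiv.Perm.mul_apply, ← pow_add, Nat.sub_add_cancel hkl.le] at this
        intro k hk l hl hkl
        rw [Finset.mem_coe, Finset.mem_range] at hk hl
        refine disjoint_left.2 fun x hx hy => ?_
        rcases lt_or_gt_of_ne hkl with h | h
        · exact key k l h hl x hx hy
        · exact key l k h hk x hy hx
      · exact fun k _ => (hT.pow k).mp.measurable hB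
      · exact fun k _ => measure_ne_top _ _
    rw [Finset.sum_congr rfl (fun k _ => by
      rw [measureReal_def, (hT.pow k).mp.measure_preimage hB.nullMeasurableSet,
        ← measureReal_def])] at h1
    simp only [Finset.sum_const, Finset.card_range, nsmul_eq_mul] at h1
    push_cast at h1
    rw [← h1]
    exact measureReal_le_one
  have hEbig : 1 / ((n : ℝ) + 1) ≤ μ.real E := by
    have h1 : (1 : ℝ) ≤ μ.real ((⋃ k ∈ Finset.range n, ⇑(T ^ k)⁻¹ ⁻¹' E) ∪
      ⋃ k ∈ Finset.range n, ⇑(T ^ k)⁻¹ ⁻¹' B) := by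
      have h0 : (univ : Set X) =ᵐ[μ] ((⋃ k ∈ Finset.range n, ⇑(T ^ k)⁻¹ ⁻¹' E) ∪
          ⋃ k ∈ Finset.range n, ⇑(T ^ k)⁻¹ ⁻¹' B : Set X) := (eventuallyEq_univ.2 hcover).symm
      rw [← measureReal_congr h0, probReal_univ]
    have h2 : ∀ D : Set X, MeasurableSet D →
        μ.real (⋃ k ∈ Finset.range n, ⇑(T ^ k)⁻¹ ⁻¹' D) ≤ n * μ.real D := by
      intro D hD
      refine (measureReal_biUnion_finset_le _ _).trans (le_of_eq ?_)
      rw [Finset.sum_congr rfl (fun k _ => by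
        rw [measureReal_def, (hT.pow k).mp_inv.measure_preimage hD.nullMeasurableSet,
          ← measureReal_def])]
      simp
    have h3 := h1.trans ((measureReal_union_le _ _).trans (add_le_add (h2 E hE) (h2 B hB)))
    have hn' : (0 : ℝ) < n := by exact_mod_cast hn
    rw [div_le_iff₀ (by positivity)]
    have h4 : (n : ℝ) * (n + 1) * 1 ≤ n * (n + 1) * (n * μ.real E + n * μ.real B) :=
      mul_le_mul_of_nonneg_left h3 (by positivity)
    have h5 : n * ((n * (n + 1) : ℝ) * μ.real B) ≤ n * 1 := by gcongr
    have h6 : (n : ℝ) * n * 1 ≤ n * n * (μ.real E * (n + 1)) := by nlinarith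
    exact le_of_mul_le_mul_left h6 (by positivity)
  obtain ⟨E', hE'E, hE', hE'm⟩ := exists_measurable_subset_measure_eq hE
    (by positivity) hEbig
  have hE'disj : ∀ x ∈ E', ∀ j, 1 ≤ j → j < n → (T ^ j) x ∉ E' := fun x hx j h1 h2 h3 =>
    hEdisj x (hE'E hx) j h1 h2 (hE'E h3)
  let h : X → ℕ := fun x => if hx : ∃ k, k < n ∧ (T ^ k)⁻¹ x ∈ E' then Nat.find hx else n
  have hle : ∀ x, h x ≤ n := by
    intro x
    by_cases hx : ∃ k, k < n ∧ (T ^ k)⁻¹ x ∈ E'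
    · simp only [h, dif_pos hx]; exact (Nat.find_spec hx).1.le
    · simp only [h, dif_neg hx]; exact le_rfl
  have huniq : ∀ x k l, k < l → l < n → (T ^ k)⁻¹ x ∈ E' → (T ^ l)⁻¹ x ∉ E' := by
    intro x k l hkl hl hk hl'
    refine hE'disj _ hl' (l - k) (by omega) (by omega) ?_
    convert hk using 1
    rw [← Equiv.Perm.mul_apply, ← zpow_natCast, ← zpow_natCast, ← zpow_natCast, ← zpow_neg,
      ← zpow_neg, ← zpow_add, show ((l - k : ℕ) : ℤ) + -l = -(k : ℤ) by
        push_cast [hkl.le]; ring]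
  have hiff : ∀ x k, k < n → (h x = k ↔ (T ^ k)⁻¹ x ∈ E') := by
    intro x k hk
    constructor
    · intro hx
      by_cases hex : ∃ k, k < n ∧ (T ^ k)⁻¹ x ∈ E'
      · have := (Nat.find_spec hex).2
        simp only [h, dif_pos hex] at hx
        rwa [hx] at this
      · simp only [h, dif_neg hex] at hx
        omega
    · intro hx
      have hex : ∃ k, k < n ∧ (T ^ k)⁻¹ x ∈ E' := ⟨k, hk, hx⟩
      simp only [h, dif_pos hex]
      have hs := Nat.find_spec hex
      rcases lt_trichotomy (Nat.find hex) k with hlt | heq | hgt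
      · exact absurd hx (huniq x _ _ hlt hk hs.2)
      · exact heq
      · exact absurd hs.2 (huniq x _ _ hgt hs.1 hx)
  have hmeas_lt : ∀ k, k < n → MeasurableSet (h ⁻¹' {k}) := by
    intro k hk
    have : h ⁻¹' {k} = ⇑(T ^ k)⁻¹ ⁻¹' E' := by ext x; exact hiff x k hk
    rw [this]
    exact (hT.pow k).mp_inv.measurable hE'
  refine ⟨h, ⟨?_, hle, ?_⟩, ?_⟩
  · refine measurable_to_countable' fun k => ?_
    rcases lt_trichotomy k n with hk | rfl | hk
    · exact hmeas_lt k hk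
    · have : h ⁻¹' {k} = (⋃ a ∈ Finset.range k, h ⁻¹' {a})ᶜ := by
        ext x
        have := hle x
        simp only [mem_preimage, mem_singleton_iff, Finset.mem_range, mem_compl_iff, mem_iUnion,
          exists_prop, exists_eq_right']
        omega
      rw [this]
      exact (Finset.measurableSet_biUnion _ fun a ha => hmeas_lt a (Finset.mem_range.1 ha)).compl
    · have : h ⁻¹' {k} = ∅ := eq_empty_of_forall_notMem fun x hx => by
        have h1 := hle x
        rw [show h x = k from hx] at h1
        omega
      rw [this]
      exact MeasurableSet.empty
  · intro x k hk
    rw [hiff _ _ hk, hiff _ _ (by omega)]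
    rw [pow_succ' T, mul_inv_rev, Equiv.Perm.mul_apply]
    simp
  · rw [← hE'm]
    congr 1
    ext x
    simpa using hiff x 0 hn

end Rokhlin

section Approximation
open Set

/-- The permutation of `X × Y` acting on the fibre over `t` by `R t`. -/
def fiberPerm {X Y : Type*} (R : Y → Equiv.Perm X) : Equiv.Perm (X × Y) where
  toFun p := (R p.2 p.1, p.2)
  invFun p := ((R p.2)⁻¹ p.1, p.2)
  left_inv p := by simp
  right_inv p := by simp

theorem fiberPerm_inv {X Y : Type*} (R : Y → Equiv.Perm X) :
    (fiberPerm R)⁻¹ = fiberPerm fun t => (R t)⁻¹ := rfl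

theorem fiberPerm_pow {X Y : Type*} (R : Y → Equiv.Perm X) (m : ℕ) :
    fiberPerm R ^ m = fiberPerm fun t => R t ^ m := by
  induction m with
  | zero => rfl
  | succ m ih =>
    rw [pow_succ, ih]
    ext p <;> simp [fiberPerm, pow_succ]

theorem fiberPerm_zpow {X Y : Type*} (R : Y → Equiv.Perm X) (m : ℤ) :
    fiberPerm R ^ m = fiberPerm fun t => R t ^ m := by
  cases m with
  | ofNat m => simpa using fiberPerm_pow R m
  | negSucc m => simp only [zpow_negSucc, fiberPerm_pow, fiberPerm_inv]

section
variable {X Y ι : Type*} [MeasurableSpace X] [MeasurableSpace Y] [Countable ι]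
  [MeasurableSpace ι] [MeasurableSingletonClass ι] {μ : Measure X} {ν : Measure Y}
  {R : ι → Equiv.Perm X} {b : Y → ι}

theorem measurePreserving_fiberPerm [SFinite μ] [SFinite ν]
    (hR : ∀ a, MeasurePreserving (R a) μ μ) (hb : Measurable b) :
    MeasurePreserving (fiberPerm fun t => R (b t)) (μ.prod ν) (μ.prod ν) := by
  have hm : Measurable fun p : ι × X => R p.1 p.2 :=
    measurable_from_prod_countable_right fun a => (hR a).measurable
  have hm' : Measurable fun p : Y × X => R (b p.1) p.2 :=
    hm.comp ((hb.comp measurable_fst).prodMk measurable_snd)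
  have h := (MeasurePreserving.id ν).skew_product (g := fun t => R (b t)) hm'
    (ae_of_all _ fun t => (hR (b t)).map_eq)
  exact (Measure.measurePreserving_swap.comp h).comp Measure.measurePreserving_swap

theorem isAut_fiberPerm [SFinite μ] [SFinite ν] (hR : ∀ a, IsAut μ (R a)) (hb : Measurable b) :
    IsAut (μ.prod ν) (fiberPerm fun t => R (b t)) :=
  ⟨measurePreserving_fiberPerm (fun a => (hR a).mp) hb, by
    rw [fiberPerm_inv]
    exact measurePreserving_fiberPerm (R := fun a => (R a)⁻¹) (fun a => (hR a).mp_inv) hb⟩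

end

theorem isAper_fiberPerm {X Y ι : Type*} [MeasurableSpace X] [MeasurableSpace Y] [Countable ι]
    {μ : Measure X} {ν : Measure Y} [SFinite ν] {R : ι → Equiv.Perm X} {b : Y → ι}
    (hR : ∀ a, IsAper μ (R a)) :
    IsAper (μ.prod ν) (fiberPerm fun t => R (b t)) := by
  refine measure_mono_null (t := ⋃ a, {x | ∃ n : ℕ, 0 < n ∧ (R a ^ n) x = x} ×ˢ univ) ?_ ?_
  · rintro p ⟨n, hn, hp⟩
    rw [fiberPerm_pow] at hp
    exact mem_iUnion.2 ⟨b p.2, ⟨n, hn, congrArg Prod.fst hp⟩, mem_univ _⟩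
  · refine measure_iUnion_null fun a => ?_
    have : μ {x | ∃ n : ℕ, 0 < n ∧ (R a ^ n) x = x} = 0 := hR a
    rw [Measure.prod_prod, this, zero_mul]

/-- The conjugate of a permutation under a measurable equivalence. -/
def conjPerm {X Y : Type*} [MeasurableSpace X] [MeasurableSpace Y] (θ : X ≃ᵐ Y)
    (R : Equiv.Perm Y) : Equiv.Perm X := θ.toEquiv.symm.permCongrHom R

section
variable {X Y : Type*} [MeasurableSpace X] [MeasurableSpace Y] {μ : Measure X} {ν : Measure Y}
  {θ : X ≃ᵐ Y} {R : Equiv.Perm Y}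

theorem conjPerm_apply (θ : X ≃ᵐ Y) (R : Equiv.Perm Y) (x : X) :
    conjPerm θ R x = θ.symm (R (θ x)) := rfl

theorem conjPerm_zpow_apply (θ : X ≃ᵐ Y) (R : Equiv.Perm Y) (m : ℤ) (x : X) :
    (conjPerm θ R ^ m) x = θ.symm ((R ^ m) (θ x)) := by
  rw [conjPerm, ← map_zpow]; rfl

theorem isAut_conjPerm (hθ : MeasurePreserving θ μ ν) (hR : IsAut ν R) :
    IsAut μ (conjPerm θ R) :=
  ⟨(hθ.symm.comp hR.mp).comp hθ, (hθ.symm.comp hR.mp_inv).comp hθ⟩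

theorem isAper_conjPerm (hθ : MeasurePreserving θ μ ν) (hR : IsAper ν R) :
    IsAper μ (conjPerm θ R) := by
  refine measure_mono_null ?_ (hθ.quasiMeasurePreserving.preimage_null hR)
  rintro x ⟨n, hn, hx⟩
  refine ⟨n, hn, ?_⟩
  rw [← zpow_natCast, conjPerm_zpow_apply, zpow_natCast] at hx
  rw [← θ.apply_symm_apply ((R ^ n) (θ x)), hx]

theorem measureReal_conjPerm (hθ : MeasurePreserving θ μ ν) (m : ℤ) (A B : Set Y) :
    μ.real (θ ⁻¹' A ∩ ⇑(conjPerm θ R ^ m) ⁻¹' (θ ⁻¹' B)) = ν.real (A ∩ ⇑(R ^ m) ⁻¹' B) := by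
  rw [measureReal_def, measureReal_def, ← hθ.measure_preimage_equiv]
  congr 2
  ext x
  simp [conjPerm_zpow_apply]

end

theorem exists_two_div_le {δ : ℝ} (hδ : 0 < δ) : ∃ n : ℕ, 0 < n ∧ 2 / ((n : ℝ) + 1) ≤ δ := by
  obtain ⟨n, hn⟩ := exists_nat_gt (2 / δ)
  have hpos : (0 : ℝ) < n := (by positivity : (0 : ℝ) < 2 / δ).trans hn
  refine ⟨n, by exact_mod_cast hpos, ?_⟩
  rw [div_lt_iff₀ hδ] at hn
  rw [div_le_iff₀ (by positivity)]
  nlinarith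

/-- Any two aperiodic transformations are almost conjugate in the uniform metric. -/
theorem IsAper.exists_conj_close {X Y : Type*} [MetricSpace X]
    [TopologicalSpace.SeparableSpace X] [MeasurableSpace X] [BorelSpace X] [StandardBorelSpace X]
    [MetricSpace Y] [TopologicalSpace.SeparableSpace Y] [MeasurableSpace Y] [BorelSpace Y]
    [StandardBorelSpace Y] [Nonempty X] [Nonempty Y] {μ : Measure X} {ν : Measure Y}
    [IsProbabilityMeasure μ] [IsProbabilityMeasure ν] [NullSingletonClass μ]
    [NullSingletonClass ν] {S : Equiv.Perm X} {T : Equiv.Perm Y}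
    (hS : IsAut μ S) (haS : IsAper μ S) (hT : IsAut ν T) (haT : IsAper ν T) {δ : ℝ}
    (hδ : 0 < δ) :
    ∃ θ : X ≃ᵐ Y, MeasurePreserving θ μ ν ∧
      μ {x | S x ≠ conjPerm θ T x} ≤ ENNReal.ofReal δ := by
  obtain ⟨n, hn, hnδ⟩ := exists_two_div_le hδ
  obtain ⟨h, ht, h0⟩ := haS.exists_isTower hS hn
  obtain ⟨h', ht', h0'⟩ := haT.exists_isTower hT hn
  have hempty : ∀ a, n < a → h ⁻¹' {a} = ∅ ∧ h' ⁻¹' {a} = ∅ := fun a ha =>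
    ⟨eq_empty_of_forall_notMem fun x (hx : h x = a) => (ht.le x).not_gt (hx ▸ ha),
      eq_empty_of_forall_notMem fun x (hx : h' x = a) => (ht'.le x).not_gt (hx ▸ ha)⟩
  obtain ⟨e, he, heh⟩ := exists_measurePreserving_of_measure_fiber_eq μ ν ht.measurable
    ht'.measurable (fun a => by
      rcases le_or_gt a n with ha | ha
      · rw [ht.measure_fiber_eq hS hn h0 ha, ht'.measure_fiber_eq hT hn h0' ha]
      · rw [(hempty a ha).1, (hempty a ha).2]; simp) (fun a => by
      rcases le_or_gt a n with ha | ha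
      · left
        rw [ht.measure_fiber_eq hS hn h0 ha]
        simp only [ne_eq, ENNReal.ofReal_eq_zero, not_le]
        positivity
      · exact Or.inr (hempty a ha))
  obtain ⟨θ, hθ, -, hθS⟩ := IsTower.exists_conj hS hT ht ht' e he heh
  refine ⟨θ, hθ, (measure_mono ?_).trans ((ht.measure_top_le hS hn h0).trans
    (ENNReal.ofReal_le_ofReal hnδ))⟩
  intro x hx hlt
  refine hx ?_
  rw [conjPerm_apply, ← hθS x hlt, MeasurableEquiv.symm_apply_apply]

/-- An aperiodic transformation is almost conjugate, in the uniform metric, to its product with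
the identity of the unit interval, by a conjugacy respecting a given finite partition. -/
theorem IsAper.exists_conj_prod_close {X ι : Type*} [MetricSpace X]
    [TopologicalSpace.SeparableSpace X] [MeasurableSpace X] [BorelSpace X] [StandardBorelSpace X]
    [Nonempty X] {μ : Measure X} [IsProbabilityMeasure μ] [NullSingletonClass μ]
    {S : Equiv.Perm X} (hS : IsAut μ S) (haS : IsAper μ S) [Finite ι] [MeasurableSpace ι]
    [DiscreteMeasurableSpace ι] {P : X → ι} (hP : Measurable P) {δ : ℝ} (hδ : 0 < δ) :
    ∃ θ : X ≃ᵐ X × unitInterval, MeasurePreserving θ μ (μ.prod volume) ∧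
      (∀ᵐ x ∂μ, P (θ x).1 = P x) ∧
      μ {x | S x ≠ conjPerm θ (fiberPerm fun _ => S) x} ≤ ENNReal.ofReal δ := by
  obtain ⟨n, hn, hnδ⟩ := exists_two_div_le hδ
  obtain ⟨h, ht, h0⟩ := haS.exists_isTower hS hn
  let i : X → ℕ × (Fin n → ι) := fun x => (h x, fun k => P ((S ^ (k : ℕ)) x))
  have hi : Measurable i := ht.measurable.prodMk
    (measurable_pi_lambda _ fun k => hP.comp (hS.pow k).mp.measurable)
  obtain ⟨e, he, hei, heg⟩ := exists_measurePreserving_prod_unitInterval μ hi Prod.fst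
    (fun x => by
      have := ht.measure_fiber_eq hS hn h0 (ht.le x)
      change μ (h ⁻¹' {h x}) ≠ 0
      rw [this]
      simp only [ne_eq, ENNReal.ofReal_eq_zero, not_le]
      positivity)
  let R : Equiv.Perm (X × unitInterval) := fiberPerm fun _ => S
  have hR : IsAut (μ.prod (volume : Measure unitInterval)) R :=
    isAut_fiberPerm (ι := Unit) (R := fun _ => S) (b := fun _ => ()) (fun _ => hS)
      measurable_const
  have ht' : IsTower R n (h ∘ Prod.fst) :=
    ⟨ht.measurable.comp measurable_fst, fun x => ht.le _, fun x k hk => ht.succ_iff x.1 k hk⟩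
  obtain ⟨θ, hθ, hθe, hθS⟩ := IsTower.exists_conj hS hR ht ht' e he heg
  refine ⟨θ, hθ, ?_, (measure_mono ?_).trans ((ht.measure_top_le hS hn h0).trans
    (ENNReal.ofReal_le_ofReal hnδ))⟩
  · have hall : ∀ᵐ x ∂μ, ∀ k : ℕ, i (e ((S ^ k)⁻¹ x)).1 = i ((S ^ k)⁻¹ x) :=
      ae_all_iff.2 fun k => (hS.pow k).mp_inv.quasiMeasurePreserving.ae hei
    filter_upwards [hall] with x hx
    have hlt : IsTower.lift n (h x) < n := by
      unfold IsTower.lift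
      split_ifs with hlt
      · exact hlt
      · exact hn
    have hk := congrFun (congrArg Prod.snd (hx (IsTower.lift n (h x)))) ⟨_, hlt⟩
    rw [hθe x, fiberPerm_pow]
    simpa [i, fiberPerm] using hk
  · intro x hx hlt
    refine hx ?_
    rw [conjPerm_apply, ← hθS x hlt, MeasurableEquiv.symm_apply_apply]

end Approximation

section Mixing
open Set

theorem measureReal_eq_sum_inter_fiber {X ι : Type*} [MeasurableSpace X] [Fintype ι]
    [MeasurableSpace ι] [MeasurableSingletonClass ι] (μ : Measure X) [IsFiniteMeasure μ]
    {i : X → ι} (hi : Measurable i) {s : Set X} (hs : MeasurableSet s) :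
    μ.real s = ∑ a, μ.real (s ∩ i ⁻¹' {a}) := by
  rw [measureReal_def, measure_eq_tsum_inter_fiber μ hi hs, tsum_fintype,
    ENNReal.toReal_sum fun a _ => measure_ne_top _ _]
  rfl

theorem measureReal_fiberPerm {X Y ι : Type*} [MeasurableSpace X] [MeasurableSpace Y] [Fintype ι]
    [MeasurableSpace ι] [MeasurableSingletonClass ι] {μ : Measure X} {ν : Measure Y}
    [IsFiniteMeasure μ] [IsFiniteMeasure ν] {R : ι → Equiv.Perm X} {b : Y → ι}
    (hR : ∀ a, IsAut μ (R a)) (hb : Measurable b) (m : ℤ) {A B : Set X} (hA : MeasurableSet A)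
    (hB : MeasurableSet B) :
    (μ.prod ν).real ((Prod.fst ⁻¹' A) ∩
      ⇑((fiberPerm fun t => R (b t)) ^ m) ⁻¹' (Prod.fst ⁻¹' B)) =
      ∑ a, ν.real (b ⁻¹' {a}) * μ.real (A ∩ ⇑(R a ^ m) ⁻¹' B) := by
  have hmeas := ((isAut_fiberPerm (ν := ν) hR hb).zpow m).mp.measurable
  rw [measureReal_eq_sum_inter_fiber _ (hb.comp measurable_snd)
    ((measurable_fst hA).inter (hmeas (measurable_fst hB)))]
  refine Finset.sum_congr rfl fun a _ => ?_
  rw [mul_comm, ← measureReal_prod_prod]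
  congr 1
  ext ⟨x, t⟩
  rw [fiberPerm_zpow]
  simp only [fiberPerm, mem_inter_iff, mem_preimage, mem_singleton_iff,
    Function.comp_apply, mem_prod, Equiv.coe_fn_mk]
  constructor
  · rintro ⟨h, rfl⟩; exact ⟨h, rfl⟩
  · rintro ⟨h, rfl⟩; exact ⟨h, rfl⟩

theorem sum_measureReal_fiber_mul_ite {Y : Type*} [MeasurableSpace Y] {N : ℕ} {ν : Measure Y}
    [IsProbabilityMeasure ν] {b : Y → Fin N → Bool} (hb : Measurable b) (j : Fin N) (p q : ℝ) :
    ∑ ξ, ν.real (b ⁻¹' {ξ}) * (if ξ j then p else q) =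
      (1 - ν.real {t | b t j}) * q + ν.real {t | b t j} * p := by
  have hm : ∀ ξ, MeasurableSet (b ⁻¹' {ξ}) := fun ξ => hb (measurableSet_singleton ξ)
  have h1 : ∑ ξ with ξ j = true, ν.real (b ⁻¹' {ξ}) = ν.real {t | b t j} := by
    rw [sum_measureReal_preimage_singleton _ fun ξ _ => hm ξ]
    congr 1
    ext t
    simp
  have h2 : ∑ ξ, ν.real (b ⁻¹' {ξ}) = 1 := by
    rw [sum_measureReal_preimage_singleton _ fun ξ _ => hm ξ]
    simp
  rw [← h2, ← h1, ← Finset.sum_filter_add_sum_filter_not Finset.univ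
    (fun ξ : Fin N → Bool => ξ j = true) (fun ξ => ν.real (b ⁻¹' {ξ})),
    ← Finset.sum_filter_add_sum_filter_not Finset.univ (fun ξ : Fin N → Bool => ξ j = true)
    (fun ξ => ν.real (b ⁻¹' {ξ}) * (if ξ j then p else q)),
    Finset.sum_congr rfl (g := fun ξ => ν.real (b ⁻¹' {ξ}) * p) fun ξ hξ => by
      rw [if_pos (Finset.mem_filter.1 hξ).2],
    Finset.sum_congr (s₁ := Finset.univ.filter fun ξ : Fin N → Bool => ¬ ξ j = true) rfl
      (g := fun ξ => ν.real (b ⁻¹' {ξ}) * q) fun ξ hξ => by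
      rw [if_neg (Finset.mem_filter.1 hξ).2],
    ← Finset.sum_mul, ← Finset.sum_mul]
  ring

/-- Along `ψ`, the transformation `T` is mixing in the coordinates where `ξ` is true and rigid in
the others. -/
def MixesAlong {N : ℕ} (ψ : Fin N → ℕ → ℤ) (ξ : Fin N → Bool) (T : Equiv.Perm unitInterval) :
    Prop :=
  ∀ j A B, MeasurableSet A → MeasurableSet B →
    Tendsto (fun k => volume.real (A ∩ ⇑(T ^ ψ j k) ⁻¹' B)) atTop
      (𝓝 (if ξ j then volume.real A * volume.real B else volume.real (A ∩ B)))

theorem exists_close_mixing {N : ℕ} {ψ : Fin N → ℕ → ℤ}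
    (hC : ∀ ξ : Fin N → Bool, ∃ T : Equiv.Perm unitInterval, IsAut volume T ∧
      IsAper volume T ∧ MixesAlong ψ ξ T)
    {lam : Fin N → ℝ} (hlam : ∀ j, lam j ∈ Set.Icc (0 : ℝ) 1) {S : Equiv.Perm unitInterval}
    (hS : IsAut volume S) (haS : IsAper volume S) {ι : Type*} [Finite ι]
    {C : ι → Set unitInterval} (hCm : ∀ a, MeasurableSet (C a)) {δ : ℝ} (hδ : 0 < δ) :
    ∃ T : Equiv.Perm unitInterval, IsAut volume T ∧ IsAper volume T ∧
      volume {x | S x ≠ T x} ≤ ENNReal.ofReal δ ∧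
      ∀ j a a', Tendsto (fun k => volume.real (C a ∩ ⇑(T ^ ψ j k) ⁻¹' C a')) atTop
        (𝓝 ((1 - lam j) * volume.real (C a ∩ C a') +
          lam j * (volume.real (C a) * volume.real (C a')))) := by
  classical
  choose Q hQ haQ hQm using hC
  let c : ℝ := Fintype.card (Fin N → Bool)
  have hc : 0 < c := Nat.cast_pos.2 Fintype.card_pos
  have hθ := fun ξ => haS.exists_conj_close hS (hQ ξ) (haQ ξ) (δ := δ / 2 / c) (by positivity)
  choose θ hθ hθS using hθ
  let R : (Fin N → Bool) → Equiv.Perm unitInterval := fun ξ => conjPerm (θ ξ) (Q ξ)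
  have hR : ∀ ξ, IsAut volume (R ξ) := fun ξ => isAut_conjPerm (hθ ξ) (hQ ξ)
  have haR : ∀ ξ, IsAper volume (R ξ) := fun ξ => isAper_conjPerm (hθ ξ) (haQ ξ)
  have hRm : ∀ ξ, MixesAlong ψ ξ (R ξ) := by
    intro ξ j A B hA hB
    have := hQm ξ j _ _ ((θ ξ).symm.measurable hA) ((θ ξ).symm.measurable hB)
    rw [← preimage_inter, measureReal_def, measureReal_def, measureReal_def,
      (hθ ξ).symm.measure_preimage hA.nullMeasurableSet,
      (hθ ξ).symm.measure_preimage hB.nullMeasurableSet,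
      (hθ ξ).symm.measure_preimage (hA.inter hB).nullMeasurableSet] at this
    refine this.congr fun k => ?_
    have hcancel : ∀ D : Set unitInterval, θ ξ ⁻¹' ((θ ξ).symm ⁻¹' D) = D := fun D => by
      rw [← preimage_comp, MeasurableEquiv.symm_comp_self, preimage_id]
    rw [← measureReal_conjPerm (hθ ξ), hcancel, hcancel]
  let b : unitInterval → Fin N → Bool := fun t j => decide ((t : ℝ) ≤ lam j)
  have hb : Measurable b := measurable_pi_lambda _ fun j =>
    measurable_to_bool <| by
      have h := measurableSet_le (measurable_subtype_coe (p := (· ∈ unitInterval)))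
        (measurable_const (a := lam j))
      convert h using 1
      ext t
      simp [b]
  have hbvol : ∀ j, volume.real {t | b t j} = lam j := by
    intro j
    have : {t | b t j} = Iic (⟨lam j, hlam j⟩ : unitInterval) := by
      ext t
      simp only [b, decide_eq_true_eq, mem_ofPred_eq, mem_Iic]
      rfl
    rw [this, measureReal_def, unitInterval.volume_Iic, ENNReal.toReal_ofReal (hlam j).1]
  let P : unitInterval → ι → Bool := fun x a => decide (x ∈ C a)
  have hP : Measurable P := measurable_pi_lambda _ fun a => measurable_to_bool <| by
      convert hCm a using 1
      ext x
      simp [P]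
  obtain ⟨Φ, hΦ, hΦP, hΦS⟩ := haS.exists_conj_prod_close hS hP (half_pos hδ)
  let T₀ : Equiv.Perm (unitInterval × unitInterval) := fiberPerm fun t => R (b t)
  have hT₀ : IsAut (volume.prod volume) T₀ := isAut_fiberPerm hR hb
  refine ⟨conjPerm Φ T₀, isAut_conjPerm hΦ hT₀, isAper_conjPerm hΦ (isAper_fiberPerm haR), ?_, ?_⟩
  · have hsub : {x | S x ≠ conjPerm Φ T₀ x} ⊆ {x | S x ≠ conjPerm Φ (fiberPerm fun _ => S) x} ∪
        Φ ⁻¹' (⋃ ξ, {x | S x ≠ R ξ x} ×ˢ univ) := by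
      intro x hx
      by_contra hcon
      simp only [mem_union, mem_ofPred_eq, mem_preimage, mem_iUnion, mem_prod, mem_univ, and_true,
        not_or, not_exists, not_not] at hcon
      refine hx ?_
      rw [hcon.1, conjPerm_apply, conjPerm_apply]
      congr 1
      exact Prod.ext (hcon.2 _) rfl
    refine (measure_mono hsub).trans ((measure_union_le _ _).trans ?_)
    rw [hΦ.measure_preimage_equiv]
    have h2 : (volume.prod volume : Measure (unitInterval × unitInterval))
        (⋃ ξ, {x | S x ≠ R ξ x} ×ˢ univ) ≤ ENNReal.ofReal (δ / 2) := by
      refine (measure_iUnion_fintype_le _ _).trans ?_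
      refine (Finset.sum_le_sum (g := fun _ => ENNReal.ofReal (δ / 2 / c)) fun ξ _ => ?_).trans ?_
      · rw [Measure.prod_prod, measure_univ, mul_one]
        exact hθS ξ
      · rw [Finset.sum_const, Finset.card_univ, ← ENNReal.ofReal_nsmul, nsmul_eq_mul]
        refine ENNReal.ofReal_le_ofReal (le_of_eq ?_)
        change c * (δ / 2 / c) = δ / 2
        field_simp
    refine (add_le_add hΦS h2).trans (le_of_eq ?_)
    rw [← ENNReal.ofReal_add (by positivity) (by positivity), add_halves]
  · intro j a a'
    have hCae : ∀ a, (C a : Set unitInterval) =ᵐ[volume] (Φ ⁻¹' (Prod.fst ⁻¹' C a) : Set _) := by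
      intro a
      filter_upwards [hΦP] with x hx
      have := congrFun hx a
      simp only [P, decide_eq_decide] at this
      exact propext this.symm
    have hval : ∀ m : ℤ, volume.real (C a ∩ ⇑(conjPerm Φ T₀ ^ m) ⁻¹' C a') =
        ∑ ξ, volume.real (b ⁻¹' {ξ}) * volume.real (C a ∩ ⇑(R ξ ^ m) ⁻¹' C a') := by
      intro m
      rw [← measureReal_fiberPerm hR hb m (hCm a) (hCm a'), ← measureReal_conjPerm hΦ]
      refine measureReal_congr ((hCae a).inter ?_)
      exact ((isAut_conjPerm hΦ hT₀).zpow m).mp.quasiMeasurePreserving.preimage_ae_eq (hCae a')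
    simp only [hval]
    have hsum := sum_measureReal_fiber_mul_ite (ν := volume) hb j
      (volume.real (C a) * volume.real (C a')) (volume.real (C a ∩ C a'))
    rw [hbvol] at hsum
    rw [← hsum]
    exact tendsto_finsetSum _ fun ξ _ => (hRm ξ j _ _ (hCm a) (hCm a')).const_mul _

end Mixing

section WeakTopology
open Set

theorem abs_measureReal_inter_sub_le {X : Type*} [MeasurableSpace X] (μ : Measure X)
    [IsFiniteMeasure μ] (A B A' B' : Set X) :
    |μ.real (A ∩ B) - μ.real (A' ∩ B')| ≤ μ.real (symmDiff A A') + μ.real (symmDiff B B') := by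
  have key : ∀ A B A' B' : Set X, μ.real (A ∩ B) ≤
      μ.real (A' ∩ B') + (μ.real (symmDiff A A') + μ.real (symmDiff B B')) := by
    intro A B A' B'
    have hsub : A ∩ B ⊆ (A' ∩ B') ∪ (symmDiff A A' ∪ symmDiff B B') := by
      intro x hx
      simp only [mem_union, mem_inter_iff, mem_symmDiff] at hx ⊢
      tauto
    refine (measureReal_mono hsub).trans ((measureReal_union_le _ _).trans ?_)
    gcongr
    exact measureReal_union_le _ _
  rw [abs_le]
  constructor
  · have := key A' B' A B
    rw [symmDiff_comm A', symmDiff_comm B'] at this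
    linarith
  · linarith [key A B A' B']

namespace Aut01

theorem isAut (T : Aut01) : IsAut volume T.toEquiv :=
  ⟨T.measurePreserving_toFun, T.measurePreserving_invFun⟩

/-- Bundle a measure-preserving permutation of the unit interval. -/
def ofIsAut {T : Equiv.Perm unitInterval} (hT : IsAut volume T) : Aut01 := ⟨T, hT.mp, hT.mp_inv⟩

theorem measurableSet_dyadic (ℓ k : ℕ) : MeasurableSet (dyadic ℓ k) :=
  (measurableSet_le measurable_const measurable_subtype_coe).inter
    (measurableSet_lt measurable_subtype_coe measurable_const)

/-- The contribution of the dyadic intervals of rank `ℓ + 1` to the distance `wDist`. -/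
def wTerm (T S : Aut01) (ℓ : ℕ) : ℝ :=
  (1 / 2 ^ (2 * (ℓ + 1)) : ℝ) *
    ∑ k ∈ Finset.range (2 ^ (ℓ + 1)),
      volume.real (symmDiff (T.toEquiv '' dyadic (ℓ + 1) k) (S.toEquiv '' dyadic (ℓ + 1) k))

theorem wDist_eq (T S : Aut01) : wDist T S = ∑' ℓ, wTerm T S ℓ := rfl

theorem wTerm_nonneg (T S : Aut01) (ℓ : ℕ) : 0 ≤ wTerm T S ℓ :=
  mul_nonneg (by positivity) (Finset.sum_nonneg fun _ _ => measureReal_nonneg)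

theorem wTerm_le_of_forall {T S : Aut01} {ℓ : ℕ} {c : ℝ}
    (h : ∀ k, volume.real (symmDiff (T.toEquiv '' dyadic (ℓ + 1) k)
      (S.toEquiv '' dyadic (ℓ + 1) k)) ≤ c) : wTerm T S ℓ ≤ (1 / 2 / 2 ^ ℓ) * c := by
  have h1 : ∑ k ∈ Finset.range (2 ^ (ℓ + 1)),
      volume.real (symmDiff (T.toEquiv '' dyadic (ℓ + 1) k) (S.toEquiv '' dyadic (ℓ + 1) k)) ≤
      2 ^ (ℓ + 1) * c := by
    refine (Finset.sum_le_sum fun k _ => h k).trans (le_of_eq ?_)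
    simp
  refine (mul_le_mul_of_nonneg_left h1 (by positivity)).trans (le_of_eq ?_)
  rw [pow_mul, show ((2 : ℝ) ^ 2) ^ (ℓ + 1) = 2 ^ (ℓ + 1) * 2 ^ (ℓ + 1) by
    rw [← pow_mul, ← pow_add]; ring_nf]
  field_simp
  ring

theorem wTerm_le (T S : Aut01) (ℓ : ℕ) : wTerm T S ℓ ≤ 1 / 2 / 2 ^ ℓ := by
  simpa using wTerm_le_of_forall (T := T) (S := S) (ℓ := ℓ) fun k => measureReal_le_one

theorem summable_wTerm (T S : Aut01) : Summable (wTerm T S) :=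
  Summable.of_nonneg_of_le (wTerm_nonneg T S) (wTerm_le T S) (summable_geometric_two' 1)

theorem wDist_self (T : Aut01) : wDist T T = 0 := by
  simp [wDist]

theorem wDist_triangle (T S R : Aut01) : wDist T R ≤ wDist T S + wDist S R := by
  rw [wDist_eq, wDist_eq, wDist_eq, ← (summable_wTerm T S).tsum_add (summable_wTerm S R)]
  refine (summable_wTerm T R).tsum_le_tsum (fun ℓ => ?_)
    ((summable_wTerm T S).add (summable_wTerm S R))
  simp only [wTerm]
  rw [← mul_add, ← Finset.sum_add_distrib]
  gcongr
  exact measureReal_symmDiff_le _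

theorem isOpen_ball (T : Aut01) {ε : ℝ} (hε : 0 < ε) : IsOpen {S | wDist T S < ε} :=
  TopologicalSpace.isOpen_generateFrom_of_mem ⟨T, ε, hε, rfl⟩

theorem exists_ball_subset {U : Set Aut01} (hU : IsOpen U) {S : Aut01} (hS : S ∈ U) :
    ∃ ε > 0, {T | wDist S T < ε} ⊆ U := by
  induction hU with
  | basic s hs =>
    obtain ⟨R, ε, -, rfl⟩ := hs
    refine ⟨ε - wDist R S, sub_pos.2 hS, fun T hT => ?_⟩
    have h1 := wDist_triangle R S T
    have h2 : wDist S T < ε - wDist R S := hT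
    change wDist R T < ε
    linarith
  | univ => exact ⟨1, one_pos, subset_univ _⟩
  | inter s t _ _ ihs iht =>
    obtain ⟨ε, hε, h⟩ := ihs hS.1
    obtain ⟨η, hη, h'⟩ := iht hS.2
    refine ⟨min ε η, lt_min hε hη, fun T hT => ?_⟩
    have hT' : wDist S T < min ε η := hT
    exact ⟨h (hT'.trans_le (min_le_left _ _)), h' (hT'.trans_le (min_le_right _ _))⟩
  | sUnion s _ ih =>
    obtain ⟨t, ht, hSt⟩ := hS
    obtain ⟨ε, hε, h⟩ := ih t ht hSt
    exact ⟨ε, hε, h.trans (subset_sUnion_of_mem ht)⟩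

theorem tendsto_wDist (S : Aut01) : Tendsto (wDist S) (𝓝 S) (𝓝 0) := by
  rw [Metric.tendsto_nhds]
  intro ε hε
  filter_upwards [(isOpen_ball S hε).mem_nhds (by simpa [wDist_self] using hε)] with T hT
  rw [Real.dist_eq, sub_zero, wDist_eq, abs_of_nonneg (tsum_nonneg (wTerm_nonneg S T))]
  exact hT

theorem measure_image_symmDiff_le (T S : Aut01) {E : Set unitInterval} (hE : MeasurableSet E) :
    volume.real (symmDiff (T.toEquiv '' E) (S.toEquiv '' E)) ≤
      2 * volume.real {x | T.toEquiv x ≠ S.toEquiv x} := by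
  have key : ∀ T S : Aut01, volume.real (T.toEquiv '' E \ S.toEquiv '' E) ≤
      volume.real {x | T.toEquiv x ≠ S.toEquiv x} := by
    intro T S
    have hsub : ⇑T.toEquiv ⁻¹' (T.toEquiv '' E \ S.toEquiv '' E) ⊆
        {x | T.toEquiv x ≠ S.toEquiv x} := by
      rintro x ⟨⟨y, hy, hyx⟩, hx⟩ heq
      rw [T.toEquiv.injective hyx] at hy
      exact hx ⟨x, hy, heq.symm⟩
    have himg : ∀ T : Aut01, MeasurableSet (T.toEquiv '' E) := fun T => by
      rw [Equiv.image_eq_preimage_symm]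
      exact T.measurePreserving_invFun.measurable hE
    rw [measureReal_def, ← T.measurePreserving_toFun.measure_preimage
      ((himg T).diff (himg S)).nullMeasurableSet]
    exact measureReal_mono hsub
  rw [symmDiff_def, two_mul]
  refine (measureReal_union_le _ _).trans (add_le_add (key T S) ?_)
  simpa only [ne_comm] using key S T

theorem wDist_le (T S : Aut01) :
    wDist T S ≤ 2 * volume.real {x | T.toEquiv x ≠ S.toEquiv x} := by
  have hs := (summable_geometric_two' 1).mul_right
    (2 * volume.real {x | T.toEquiv x ≠ S.toEquiv x})
  refine ((summable_wTerm T S).tsum_le_tsum (fun ℓ => wTerm_le_of_forall fun k =>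
    measure_image_symmDiff_le T S (measurableSet_dyadic _ k)) hs).trans (le_of_eq ?_)
  rw [tsum_mul_right, tsum_geometric_two', one_mul]

/-- The functional `T ↦ μ (g S ⁻¹ E △ g T ⁻¹ E)` vanishes continuously at `S`. -/
def ContAt (g : Aut01 → Equiv.Perm unitInterval) (S : Aut01) (E : Set unitInterval) : Prop :=
  Tendsto (fun T => volume.real (symmDiff (g S ⁻¹' E) (g T ⁻¹' E))) (𝓝 S) (𝓝 0)

section
variable {g g' : Aut01 → Equiv.Perm unitInterval} {S : Aut01} {E F : Set unitInterval}

theorem ContAt.union (hE : ContAt g S E) (hF : ContAt g S F) : ContAt g S (E ∪ F) := by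
  have h := Tendsto.add hE hF
  rw [add_zero] at h
  refine squeeze_zero (fun _ => measureReal_nonneg) (fun T => ?_) h
  refine (measureReal_mono ?_).trans (measureReal_union_le _ _)
  intro x hx
  simp only [mem_union, mem_symmDiff, mem_preimage] at hx ⊢
  tauto

theorem ContAt.compl (hE : ContAt g S E) : ContAt g S Eᶜ := by
  simpa only [ContAt, preimage_compl, compl_symmDiff_compl] using hE

theorem ContAt.empty : ContAt g S ∅ := by
  simp [ContAt]

theorem ContAt.of_approx (hg : ∀ T, IsAut volume (g T)) (hE : MeasurableSet E)
    (h : ∀ ε > 0, ∃ F, MeasurableSet F ∧ ContAt g S F ∧ volume.real (symmDiff E F) ≤ ε) :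
    ContAt g S E := by
  rw [ContAt, Metric.tendsto_nhds]
  intro ε hε
  obtain ⟨F, hF, hFc, hEF⟩ := h (ε / 3) (by positivity)
  filter_upwards [(Metric.tendsto_nhds.1 hFc) (ε / 3) (by positivity)] with T hT
  rw [Real.dist_eq, sub_zero, abs_of_nonneg measureReal_nonneg] at hT ⊢
  have hp : ∀ T, volume.real (symmDiff (g T ⁻¹' E) (g T ⁻¹' F)) ≤ ε / 3 := fun T => by
    rw [← preimage_symmDiff, measureReal_def,
      (hg T).mp.measure_preimage (hE.symmDiff hF).nullMeasurableSet]
    exact hEF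
  have h1 := measureReal_symmDiff_le (μ := volume) (s := g S ⁻¹' E) (t := g S ⁻¹' F)
    (g T ⁻¹' E)
  have h2 := measureReal_symmDiff_le (μ := volume) (s := g S ⁻¹' F) (t := g T ⁻¹' F)
    (g T ⁻¹' E)
  have h3 := hp S
  have h4 := hp T
  rw [symmDiff_comm] at h4
  linarith

theorem ContAt.iUnion (hg : ∀ T, IsAut volume (g T)) {f : ℕ → Set unitInterval}
    (hfm : ∀ i, MeasurableSet (f i)) (hf : ∀ i, ContAt g S (f i)) :
    ContAt g S (⋃ i, f i) := by
  have hacc : ∀ n, ContAt g S (accumulate f n) := by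
    intro n
    induction n with
    | zero => simpa using hf 0
    | succ n ih => rw [accumulate_succ]; exact ih.union (hf _)
  have hm : ∀ n, MeasurableSet (accumulate f n) := fun n =>
    MeasurableSet.biUnion (to_countable _) fun i _ => hfm i
  refine ContAt.of_approx hg (MeasurableSet.iUnion hfm) fun ε hε => ?_
  have ht : Tendsto (fun n => volume.real (accumulate f n)) atTop
      (𝓝 (volume.real (⋃ i, f i))) :=
    (ENNReal.tendsto_toReal (measure_ne_top _ _)).comp tendsto_measure_iUnion_accumulate
  obtain ⟨n, hn⟩ := ((Metric.tendsto_nhds.1 ht) ε hε).exists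
  refine ⟨accumulate f n, hm n, hacc n, ?_⟩
  have hsub : accumulate f n ⊆ ⋃ i, f i := accumulate_subset_iUnion n
  rw [symmDiff_of_ge hsub, measureReal_sdiff hsub (hm n)]
  rw [Real.dist_eq, abs_sub_comm] at hn
  exact (le_abs_self _).trans hn.le

theorem contAt_inv_dyadic (S : Aut01) {ℓ k : ℕ} (hk : k < 2 ^ (ℓ + 1)) :
    ContAt (fun T => T.toEquiv⁻¹) S (dyadic (ℓ + 1) k) := by
  have h := (tendsto_wDist S).const_mul ((2 : ℝ) ^ (2 * (ℓ + 1)))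
  rw [mul_zero] at h
  refine squeeze_zero (fun _ => measureReal_nonneg) (fun T => ?_) h
  have h1 : wTerm S T ℓ ≤ wDist S T :=
    (summable_wTerm S T).le_tsum ℓ fun i _ => wTerm_nonneg S T i
  have h2 : volume.real (symmDiff (S.toEquiv '' dyadic (ℓ + 1) k)
      (T.toEquiv '' dyadic (ℓ + 1) k)) ≤ 2 ^ (2 * (ℓ + 1)) * wTerm S T ℓ := by
    rw [wTerm, ← mul_assoc, mul_one_div_cancel (by positivity), one_mul]
    exact Finset.single_le_sum (f := fun k => volume.real (symmDiff
      (S.toEquiv '' dyadic (ℓ + 1) k) (T.toEquiv '' dyadic (ℓ + 1) k)))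
      (fun _ _ => measureReal_nonneg) (Finset.mem_range.2 hk)
  rw [Equiv.image_eq_preimage_symm, Equiv.image_eq_preimage_symm] at h2
  exact h2.trans (mul_le_mul_of_nonneg_left h1 (by positivity))

theorem contAt_inv_Iio (S : Aut01) (a : unitInterval) :
    ContAt (fun T => T.toEquiv⁻¹) S (Iio a) := by
  refine ContAt.of_approx (fun T => T.isAut.inv) measurableSet_Iio fun ε hε => ?_
  obtain ⟨ℓ, hℓ⟩ := exists_pow_lt_of_lt_one hε (by norm_num : (1 / 2 : ℝ) < 1)
  have hpos : (0 : ℝ) < 2 ^ (ℓ + 1) := by positivity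
  have hdyad : ∀ K : ℕ, K ≤ 2 ^ (ℓ + 1) → ContAt (fun T => T.toEquiv⁻¹) S
      {x | (x : ℝ) < (K : ℝ) / 2 ^ (ℓ + 1)} := by
    intro K
    induction K with
    | zero =>
      intro _
      convert ContAt.empty (g := fun T : Aut01 => T.toEquiv⁻¹) (S := S)
      ext x
      simpa using x.2.1
    | succ K ih =>
      intro hK
      convert (ih (by omega)).union (contAt_inv_dyadic S (ℓ := ℓ) (k := K) (by omega)) using 1
      ext x
      simp only [mem_ofPred_eq, mem_union, dyadic]
      have hlt : (K : ℝ) / 2 ^ (ℓ + 1) < ((K : ℝ) + 1) / 2 ^ (ℓ + 1) := by gcongr; linarith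
      push_cast
      constructor
      · intro h
        rcases lt_or_ge (x : ℝ) ((K : ℝ) / 2 ^ (ℓ + 1)) with h' | h'
        · exact Or.inl h'
        · exact Or.inr ⟨h', h⟩
      · rintro (h | h)
        · exact h.trans hlt
        · exact h.2
  let K := ⌊(a : ℝ) * 2 ^ (ℓ + 1)⌋₊
  have hK1 : (K : ℝ) / 2 ^ (ℓ + 1) ≤ a := by
    rw [div_le_iff₀ hpos]
    exact Nat.floor_le (mul_nonneg a.2.1 hpos.le)
  have hK2 : (a : ℝ) < ((K : ℝ) + 1) / 2 ^ (ℓ + 1) := by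
    rw [lt_div_iff₀ hpos]
    exact Nat.lt_floor_add_one _
  have hKle : K ≤ 2 ^ (ℓ + 1) := by
    have h1 : (K : ℝ) ≤ 1 * 2 ^ (ℓ + 1) := by
      rw [← div_le_iff₀ hpos]
      exact hK1.trans a.2.2
    rw [one_mul] at h1
    exact_mod_cast h1
  refine ⟨_, measurableSet_lt measurable_subtype_coe measurable_const, hdyad K hKle, ?_⟩
  let b : unitInterval := ⟨(K : ℝ) / 2 ^ (ℓ + 1), by positivity, hK1.trans a.2.2⟩
  have hb : {x : unitInterval | (x : ℝ) < (K : ℝ) / 2 ^ (ℓ + 1)} = Iio b := rfl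
  rw [hb, symmDiff_of_ge (Iio_subset_Iio (show b ≤ a from hK1)), Iio_sdiff_Iio, measureReal_def,
    unitInterval.volume_Ico, ENNReal.toReal_ofReal (sub_nonneg.2 hK1)]
  refine le_trans ?_ hℓ.le
  change (a : ℝ) - (K : ℝ) / 2 ^ (ℓ + 1) ≤ _
  have h1 : ((K : ℝ) + 1) / 2 ^ (ℓ + 1) = (K : ℝ) / 2 ^ (ℓ + 1) + (1 / 2) * (1 / 2) ^ ℓ := by
    rw [add_div, ← pow_succ', one_div_pow]
  have h2 : (0 : ℝ) < (1 / 2) ^ ℓ := by positivity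
  linarith

theorem contAt_inv (S : Aut01) (hE : MeasurableSet E) : ContAt (fun T => T.toEquiv⁻¹) S E := by
  induction E, hE using MeasurableSpace.induction_on_inter
    (borel_eq_generateFrom_Iio unitInterval ▸ BorelSpace.measurable_eq) isPiSystem_Iio with
  | empty => exact ContAt.empty
  | basic t ht =>
    obtain ⟨a, rfl⟩ := ht
    exact contAt_inv_Iio S a
  | compl t _ ih => exact ih.compl
  | iUnion f _ hfm ih => exact ContAt.iUnion (fun T => T.isAut.inv) hfm ih

theorem contAt_of_inv (hg : ∀ T, IsAut volume (g T))
    (h : ∀ E, MeasurableSet E → ContAt (fun T => (g T)⁻¹) S E) (hE : MeasurableSet E) :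
    ContAt g S E := by
  have h' := h (g S ⁻¹' E) ((hg S).mp.measurable hE)
  refine h'.congr fun T => ?_
  have hm := ((hg S).mp.measurable hE)
  have := (hg T).mp.measure_preimage
    ((((hg S).mp_inv.measurable hm)).symmDiff ((hg T).mp_inv.measurable hm)).nullMeasurableSet
  rw [measureReal_def, ← this, ← measureReal_def]
  congr 1
  ext x
  simp [mem_symmDiff, and_comm, or_comm]

theorem contAt_mul (hg : ∀ T, IsAut volume (g T)) (hg' : ∀ T, IsAut volume (g' T))
    (h : ∀ E, MeasurableSet E → ContAt g S E) (h' : ∀ E, MeasurableSet E → ContAt g' S E)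
    (hE : MeasurableSet E) : ContAt (fun T => g T * g' T) S E := by
  have hlim := Tendsto.add (h' _ ((hg S).mp.measurable hE)) (h E hE)
  rw [add_zero] at hlim
  refine squeeze_zero (fun _ => measureReal_nonneg) (fun T => ?_) hlim
  refine (measureReal_symmDiff_le (t := g' T ⁻¹' (g S ⁻¹' E)) _).trans
    (add_le_add le_rfl (le_of_eq ?_))
  rw [Equiv.Perm.coe_mul, preimage_comp, ← preimage_symmDiff, measureReal_def,
    (hg' T).mp.measure_preimage (((hg S).mp.measurable hE).symmDiff
      ((hg T).mp.measurable hE)).nullMeasurableSet, measureReal_def]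

end

theorem contAt_zpow (S : Aut01) (m : ℤ) {E : Set unitInterval} (hE : MeasurableSet E) :
    ContAt (fun T => T.toEquiv ^ m) S E := by
  have h1 : ∀ E, MeasurableSet E → ContAt (fun T => T.toEquiv) S E := fun E hE =>
    contAt_of_inv isAut (fun E hE => contAt_inv S hE) hE
  induction m generalizing E with
  | zero => simp [ContAt]
  | succ n ih =>
    simp only [zpow_add_one]
    exact contAt_mul (fun T => T.isAut.zpow _) isAut (fun E hE => ih hE) h1 hE
  | pred n ih =>
    simp only [zpow_sub_one]
    exact contAt_mul (fun T => T.isAut.zpow _) (fun T => T.isAut.inv) (fun E hE => ih hE)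
      (fun E hE => contAt_inv S hE) hE

theorem continuous_corr (m : ℤ) (A : Set unitInterval) {B : Set unitInterval}
    (hB : MeasurableSet B) : Continuous fun T : Aut01 => T.corr m A B := by
  rw [continuous_iff_continuousAt]
  intro S
  rw [ContinuousAt, tendsto_iff_dist_tendsto_zero]
  refine squeeze_zero (fun _ => dist_nonneg) (fun T => ?_) (contAt_zpow S m hB)
  rw [dist_comm, Real.dist_eq]
  have := abs_measureReal_inter_sub_le volume A (⇑(S.toEquiv ^ m : Equiv.Perm unitInterval) ⁻¹' B)
    A (⇑(T.toEquiv ^ m : Equiv.Perm unitInterval) ⁻¹' B)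
  simpa [corr, measureReal_def] using this

end Aut01

end WeakTopology

section WeakDensity
open Set

theorem isAut_prodCongr {X Y : Type*} [MeasurableSpace X] [MeasurableSpace Y] {μ : Measure X}
    {ν : Measure Y} [SFinite μ] [SFinite ν] {S : Equiv.Perm X} {Q : Equiv.Perm Y}
    (hS : IsAut μ S) (hQ : IsAut ν Q) :
    IsAut (μ.prod ν) (Equiv.prodCongr S Q : Equiv.Perm (X × Y)) :=
  ⟨hS.mp.prod hQ.mp, hS.mp_inv.prod hQ.mp_inv⟩

theorem isAper_prodCongr {X Y : Type*} [MeasurableSpace X] [MeasurableSpace Y] (μ : Measure X)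
    {ν : Measure Y} [SFinite ν] (S : Equiv.Perm X) {Q : Equiv.Perm Y} (hQ : IsAper ν Q) :
    IsAper (μ.prod ν) (Equiv.prodCongr S Q : Equiv.Perm (X × Y)) := by
  have hpow : ∀ n : ℕ, (Equiv.prodCongr S Q : Equiv.Perm (X × Y)) ^ n =
      Equiv.prodCongr (S ^ n) (Q ^ n) := by
    intro n
    induction n with
    | zero => rfl
    | succ n ih =>
      rw [pow_succ, ih]
      ext p <;> simp [pow_succ]
  refine measure_mono_null (t := univ ×ˢ {x | ∃ n : ℕ, 0 < n ∧ (Q ^ n) x = x}) ?_ ?_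
  · rintro p ⟨n, hn, hp⟩
    rw [hpow] at hp
    exact ⟨mem_univ _, n, hn, congrArg Prod.snd hp⟩
  · have : ν {x | ∃ n : ℕ, 0 < n ∧ (Q ^ n) x = x} = 0 := hQ
    rw [Measure.prod_prod, this, mul_zero]

namespace Aut01

theorem exists_aperiodic_image_eq {Q : Equiv.Perm unitInterval} (hQ : IsAut volume Q)
    (haQ : IsAper volume Q) (S : Aut01) {ι : Type*} [Finite ι] {C : ι → Set unitInterval}
    (hC : ∀ a, MeasurableSet (C a)) :
    ∃ T : Aut01, T.Aperiodic ∧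
      ∀ a, volume.real (symmDiff (S.toEquiv '' C a) (T.toEquiv '' C a)) = 0 := by
  classical
  let P : unitInterval → ι → Bool × Bool := fun x a =>
    (decide (x ∈ C a), decide (S.toEquiv.symm x ∈ C a))
  have hP : Measurable P := by
    refine measurable_pi_lambda _ fun a => Measurable.prodMk (measurable_to_bool ?_)
      (measurable_to_bool ?_)
    · convert hC a using 1
      ext x
      simp
    · have hset : (fun x => decide (S.toEquiv.symm x ∈ C a)) ⁻¹' {true} =
          ⇑S.toEquiv.symm ⁻¹' C a := by
        ext x
        simp
      rw [hset]
      exact S.measurePreserving_invFun.measurable (hC a)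
  obtain ⟨Φ, hΦ, hΦP, -⟩ := exists_measurePreserving_prod_unitInterval volume hP
    (fun _ => ()) (fun x => by simp)
  have hR := isAut_prodCongr S.isAut hQ
  have hT := isAut_conjPerm hΦ hR
  refine ⟨ofIsAut hT, isAper_conjPerm hΦ (isAper_prodCongr volume S.toEquiv haQ), fun a => ?_⟩
  rw [Equiv.image_eq_preimage_symm, Equiv.image_eq_preimage_symm, measureReal_eq_zero_iff,
    measure_symmDiff_eq_zero_iff]
  filter_upwards [hΦP, hT.mp_inv.quasiMeasurePreserving.ae hΦP] with x hx hx'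
  have h1 := congrArg Prod.snd (congrFun hx a)
  have h2 := congrArg Prod.fst (congrFun hx' a)
  simp only [P, decide_eq_decide] at h1 h2
  have h3 : (Φ ((conjPerm Φ (Equiv.prodCongr S.toEquiv Q))⁻¹ x)).1 =
      S.toEquiv.symm (Φ x).1 := by
    change (Φ (Φ.symm ((Equiv.prodCongr S.toEquiv Q).symm (Φ x)))).1 = _
    rw [MeasurableEquiv.apply_symm_apply]
    rfl
  rw [h3] at h2
  exact propext (h1.symm.trans h2)

theorem dense_aperiodic {Q : Equiv.Perm unitInterval} (hQ : IsAut volume Q)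
    (haQ : IsAper volume Q) : Dense {T : Aut01 | T.Aperiodic} := by
  intro S
  rw [mem_closure_iff]
  intro U hU hSU
  obtain ⟨ε, hε, hball⟩ := exists_ball_subset hU hSU
  have h := fun r : ℕ => exists_aperiodic_image_eq hQ haQ S (ι := Fin r × Fin (2 ^ r))
    (C := fun p => dyadic (p.1 + 1) p.2) fun p => measurableSet_dyadic _ _
  choose T hTa hT using h
  have hlim : Tendsto (fun r => wDist S (T r)) atTop (𝓝 (∑' _ : ℕ, (0 : ℝ))) := by
    refine tendsto_tsum_of_dominated_convergence (summable_geometric_two' 1) (fun ℓ => ?_)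
      (Eventually.of_forall fun r ℓ => ?_)
    · refine tendsto_const_nhds.congr' ?_
      filter_upwards [eventually_gt_atTop (ℓ + 1)] with r hr
      refine (mul_eq_zero_of_right _ (Finset.sum_eq_zero fun k hk => ?_)).symm
      have hk' : k < 2 ^ r :=
        (Finset.mem_range.1 hk).trans_le (Nat.pow_le_pow_right (by norm_num) hr.le)
      exact hT r ⟨⟨ℓ, by omega⟩, ⟨k, hk'⟩⟩
    · change ‖wTerm S (T r) ℓ‖ ≤ _
      rw [Real.norm_of_nonneg (wTerm_nonneg _ _ _)]
      exact wTerm_le _ _ _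
  rw [tsum_zero] at hlim
  obtain ⟨r, hr⟩ := (hlim.eventually_lt_const hε).exists
  exact ⟨T r, hball hr, hTa r⟩

end Aut01
end WeakDensity

section UniformCompleteness
open Set

theorem exists_uniform_limit {u : ℕ → Equiv.Perm unitInterval} (hu : ∀ n, IsAut volume (u n))
    (hau : ∀ n, IsAper volume (u n))
    (hclose : ∀ n, volume.real {x | u n x ≠ u (n + 1) x} ≤ (1 / 2) ^ n) :
    ∃ e : Equiv.Perm unitInterval, IsAut volume e ∧ IsAper volume e ∧
      Tendsto (fun n => volume.real {x | u n x ≠ e x}) atTop (𝓝 0) := by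
  have hsum : ∑' n, volume {x | u n x ≠ u (n + 1) x} ≠ ⊤ := by
    have h1 : ∀ n, volume {x | u n x ≠ u (n + 1) x} ≤ ENNReal.ofReal ((1 / 2 : ℝ) ^ n) :=
      fun n => by
        rw [← ofReal_measureReal (measure_ne_top _ _)]
        exact ENNReal.ofReal_le_ofReal (hclose n)
    exact ne_top_of_le_ne_top summable_geometric_two.tsum_ofReal_ne_top (ENNReal.tsum_le_tsum h1)
  have hconst : ∀ᵐ x : unitInterval, ∃ y, ∀ᶠ n in atTop, u n x = y := by
    filter_upwards [ae_eventually_notMem hsum] with x hx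
    obtain ⟨m, hm⟩ := eventually_atTop.1 hx
    refine ⟨u m x, eventually_atTop.2 ⟨m, fun n hn => ?_⟩⟩
    induction n, hn using Nat.le_induction with
    | base => rfl
    | succ n hn ih =>
      have := hm n hn
      simp only [not_not] at this
      rw [← this, ih]
  obtain ⟨f, hf, hlim⟩ := measurable_limit_of_tendsto_metrizable_ae (L := atTop)
    (fun n => (hu n).mp.measurable.aemeasurable) (hconst.mono fun x hx => by
      obtain ⟨y, hy⟩ := hx
      exact ⟨y, tendsto_const_nhds.congr' (hy.mono fun n hn => hn.symm)⟩)
  have hev : ∀ᵐ x : unitInterval, ∀ᶠ n in atTop, u n x = f x := by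
    filter_upwards [hconst, hlim] with x hx hx'
    obtain ⟨y, hy⟩ := hx
    rwa [tendsto_nhds_unique hx'
      (tendsto_const_nhds.congr' (hy.mono fun n hn => hn.symm))]
  have hfmp : MeasurePreserving f volume volume := by
    refine ⟨hf, Measure.ext fun A hA => ?_⟩
    rw [Measure.map_apply hf hA]
    have h := tendsto_measure_of_ae_tendsto_indicator_of_isFiniteMeasure (μ := volume) atTop
      (hf hA) (fun n => (hu n).mp.measurable hA) (hev.mono fun x hx => hx.mono fun n hn => by
        rw [mem_preimage, mem_preimage, hn])
    simp only [fun n => (hu n).mp.measure_preimage hA.nullMeasurableSet] at h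
    exact tendsto_nhds_unique h tendsto_const_nhds |>.symm ▸ rfl
  have hinj : InjOn f (toMeasurable volume {x | ∀ᶠ n in atTop, u n x = f x}ᶜ)ᶜ := by
    have hsub := compl_subset_comm.1
      (subset_toMeasurable (volume : Measure unitInterval) {x | ∀ᶠ n in atTop, u n x = f x}ᶜ)
    intro x hx y hy hxy
    obtain ⟨n, hn1, hn2⟩ := ((hsub hx).and (hsub hy)).exists
    exact (u n).injective (by rw [hn1, hn2, hxy])
  have hunc : ¬Countable unitInterval :=
    not_countable_of_measure_univ_ne_zero (μ := volume) (by simp)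
  obtain ⟨e, he, hef⟩ := exists_measurableEquiv_ae_eq hunc hunc hfmp
    (measurableSet_toMeasurable _ _).compl
    (by rw [compl_compl, measure_toMeasurable]; exact hev) hinj
  have heA : IsAut volume e.toEquiv := ⟨he, he.symm e⟩
  have hev' : ∀ᵐ x : unitInterval, ∀ᶠ n in atTop, u n x = e.toEquiv x := by
    filter_upwards [hev, hef] with x hx hx'
    simpa only [MeasurableEquiv.coe_toEquiv, hx'] using hx
  refine ⟨e.toEquiv, heA, ?_, ?_⟩
  · have h1 : ∀ᵐ x : unitInterval, ∀ i : ℕ, ∀ᶠ n in atTop,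
        u n ((e.toEquiv ^ i : Equiv.Perm _) x) = e.toEquiv ((e.toEquiv ^ i : Equiv.Perm _) x) :=
      ae_all_iff.2 fun i => (heA.pow i).mp.quasiMeasurePreserving.ae hev'
    have h2 : ∀ᵐ x : unitInterval, ∀ n, ¬∃ p : ℕ, 0 < p ∧ (u n ^ p) x = x := by
      refine ae_all_iff.2 fun n => ?_
      rw [ae_iff]
      simp only [not_not]
      exact hau n
    have h3 : ∀ᵐ x : unitInterval, ¬∃ p : ℕ, 0 < p ∧ (e.toEquiv ^ p : Equiv.Perm _) x = x := by
      filter_upwards [h1, h2] with x hx hx'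
      rintro ⟨p, hp, hpx⟩
      have h4 : ∀ i : ℕ, ∀ᶠ n in atTop, (u n ^ i) x = (e.toEquiv ^ i : Equiv.Perm _) x := by
        intro i
        induction i with
        | zero => simp
        | succ i ih =>
          filter_upwards [ih, hx i] with n hn hn'
          rw [pow_succ', pow_succ', Equiv.Perm.mul_apply, Equiv.Perm.mul_apply, hn, hn']
      obtain ⟨n, hn⟩ := (h4 p).exists
      exact hx' n ⟨p, hp, hn.trans hpx⟩
    rw [ae_iff] at h3
    simp only [not_not] at h3
    exact h3
  · have h := tendsto_measure_of_ae_tendsto_indicator_of_isFiniteMeasure (μ := volume) atTop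
      (As := fun n => {x | u n x ≠ e.toEquiv x}) (A := ∅) MeasurableSet.empty
      (fun n => (measurableSet_eq_fun (hu n).mp.measurable heA.mp.measurable).compl)
      (hev'.mono fun x hx => hx.mono fun n hn => by simp [hn])
    rw [measure_empty] at h
    exact (ENNReal.tendsto_toReal ENNReal.zero_ne_top).comp h

/-- The aperiodic transformations, to be endowed with the uniform distance. -/
structure AperAut where
  toAut : Aut01
  aperiodic : toAut.Aperiodic

namespace AperAut

instance : PseudoMetricSpace AperAut where
  dist T S := volume.real {x | T.toAut.toEquiv x ≠ S.toAut.toEquiv x}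
  dist_self T := by simp
  dist_comm T S := by simp only [ne_comm]
  dist_triangle T S R := by
    refine (measureReal_mono ?_).trans (measureReal_union_le _ _)
    intro x hx
    by_contra h
    simp only [mem_union, mem_ofPred_eq, not_or, not_not] at h
    exact hx (h.1.trans h.2)

theorem dist_eq (T S : AperAut) :
    dist T S = volume.real {x | T.toAut.toEquiv x ≠ S.toAut.toEquiv x} := rfl

instance : CompleteSpace AperAut := by
  refine Metric.complete_of_convergent_controlled_sequences (fun n => (1 / 2) ^ n) (by simp)
    fun u hu => ?_
  obtain ⟨e, he, hae, hlim⟩ := exists_uniform_limit (fun n => (u n).toAut.isAut)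
    (fun n => (u n).aperiodic) (fun n => (hu n n (n + 1) le_rfl n.le_succ).le)
  exact ⟨⟨Aut01.ofIsAut he, hae⟩, tendsto_iff_dist_tendsto_zero.2 hlim⟩

theorem continuous_toAut : Continuous toAut := by
  refine continuous_def.2 fun U hU => Metric.isOpen_iff.2 fun S hS => ?_
  obtain ⟨ε, hε, hball⟩ := Aut01.exists_ball_subset hU hS
  refine ⟨ε / 2, by positivity, fun T hT => hball ?_⟩
  have h1 := Aut01.wDist_le S.toAut T.toAut
  rw [← dist_eq] at h1
  rw [Metric.mem_ball, dist_comm] at hT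
  change Aut01.wDist _ _ < ε
  linarith

end AperAut
end UniformCompleteness

section Residual
open Set

theorem abs_measureReal_sub_le_symmDiff {X : Type*} [MeasurableSpace X] (μ : Measure X)
    [IsFiniteMeasure μ] (A A' : Set X) : |μ.real A - μ.real A'| ≤ μ.real (symmDiff A A') := by
  simpa using abs_measureReal_inter_sub_le μ A univ A' univ

/-- The correlation of `A` and `B` that interpolates between rigidity (`c = 0`) and
mixing (`c = 1`). -/
def partialCorr (c : ℝ) (A B : Set unitInterval) : ℝ :=
  (1 - c) * volume.real (A ∩ B) + c * volume.real A * volume.real B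

theorem abs_partialCorr_sub_le {c : ℝ} (hc : c ∈ Icc (0 : ℝ) 1) (A B A' B' : Set unitInterval) :
    |partialCorr c A B - partialCorr c A' B'| ≤
      volume.real (symmDiff A A') + volume.real (symmDiff B B') := by
  have h1 := abs_measureReal_inter_sub_le volume A B A' B'
  have h2 := abs_measureReal_sub_le_symmDiff volume A A'
  have h3 := abs_measureReal_sub_le_symmDiff volume B B'
  have h4 : |volume.real A * volume.real B - volume.real A' * volume.real B'| ≤
      volume.real (symmDiff A A') + volume.real (symmDiff B B') := by
    rw [show volume.real A * volume.real B - volume.real A' * volume.real B' =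
      (volume.real A - volume.real A') * volume.real B +
        volume.real A' * (volume.real B - volume.real B') by ring]
    refine (abs_add_le _ _).trans (add_le_add ?_ ?_)
    · rw [abs_mul, abs_of_nonneg (measureReal_nonneg (s := B))]
      exact (mul_le_of_le_one_right (abs_nonneg _) measureReal_le_one).trans h2
    · rw [abs_mul, abs_of_nonneg (measureReal_nonneg (s := A'))]
      exact (mul_le_of_le_one_left (abs_nonneg _) measureReal_le_one).trans h3
  rw [show partialCorr c A B - partialCorr c A' B' =
    (1 - c) * (volume.real (A ∩ B) - volume.real (A' ∩ B')) +
      c * (volume.real A * volume.real B - volume.real A' * volume.real B') by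
    simp only [partialCorr]; ring]
  refine (abs_add_le _ _).trans ?_
  rw [abs_mul, abs_mul, abs_of_nonneg hc.1, abs_of_nonneg (sub_nonneg.2 hc.2)]
  have h5 := mul_le_mul_of_nonneg_left h1 (sub_nonneg.2 hc.2)
  have h6 := mul_le_mul_of_nonneg_left h4 hc.1
  linarith

namespace Aut01

theorem abs_corr_sub_le (T : Aut01) (m : ℤ) (A A' : Set unitInterval) {B B' : Set unitInterval}
    (hB : MeasurableSet B) (hB' : MeasurableSet B') :
    |T.corr m A B - T.corr m A' B'| ≤
      volume.real (symmDiff A A') + volume.real (symmDiff B B') := by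
  refine (abs_measureReal_inter_sub_le volume _ _ _ _).trans (add_le_add le_rfl (le_of_eq ?_))
  rw [← preimage_symmDiff, measureReal_def, (T.isAut.zpow m).mp.measure_preimage
    (hB.symmDiff hB').nullMeasurableSet, measureReal_def]

theorem tendsto_corr_of_measureDense {𝒜 : Set (Set unitInterval)}
    (h𝒜 : (volume : Measure unitInterval).MeasureDense 𝒜) {T : Aut01} {m : ℕ → ℤ} {c : ℝ}
    (hc : c ∈ Icc (0 : ℝ) 1)
    (h : ∀ A ∈ 𝒜, ∀ B ∈ 𝒜, Tendsto (fun ℓ => T.corr (m ℓ) A B) atTop (𝓝 (partialCorr c A B)))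
    {A B : Set unitInterval} (hA : MeasurableSet A) (hB : MeasurableSet B) :
    Tendsto (fun ℓ => T.corr (m ℓ) A B) atTop (𝓝 (partialCorr c A B)) := by
  have happ : ∀ E, MeasurableSet E → ∀ ε > 0, ∃ F ∈ 𝒜, volume.real (symmDiff E F) < ε := by
    intro E hE ε hε
    obtain ⟨F, hF, hEF⟩ := h𝒜.approx E hE (measure_ne_top _ _) ε hε
    exact ⟨F, hF, (ENNReal.lt_ofReal_iff_toReal_lt (measure_ne_top _ _)).1 hEF⟩
  rw [Metric.tendsto_nhds]
  intro ε hε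
  obtain ⟨A', hA', hAA'⟩ := happ A hA (ε / 5) (by positivity)
  obtain ⟨B', hB', hBB'⟩ := happ B hB (ε / 5) (by positivity)
  filter_upwards [Metric.tendsto_nhds.1 (h A' hA' B' hB') (ε / 5) (by positivity)] with ℓ hℓ
  rw [Real.dist_eq] at hℓ ⊢
  have h1 := abs_corr_sub_le T (m ℓ) A A' hB (h𝒜.measurable _ hB')
  have h2 := abs_partialCorr_sub_le hc A B A' B'
  rw [abs_sub_comm] at h2
  have h3 := abs_sub_le (T.corr (m ℓ) A B) (T.corr (m ℓ) A' B') (partialCorr c A B)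
  have h4 := abs_sub_le (T.corr (m ℓ) A' B') (partialCorr c A' B') (partialCorr c A B)
  linarith

/-- The transformations for which some subsequence of the correlations along each `ψ j`
converges to the partial correlation with parameter `lam j`. -/
def partiallyMixing {N : ℕ} (ψ : Fin N → ℕ → ℤ) (lam : Fin N → ℝ) : Set Aut01 :=
  {T | ∃ kseq : ℕ → ℕ, StrictMono kseq ∧ ∀ j A B, MeasurableSet A → MeasurableSet B →
    Tendsto (fun ℓ => T.corr (ψ j (kseq ℓ)) A B) atTop (𝓝 (partialCorr (lam j) A B))}

/-- The transformations one of whose late correlations approximate the partial correlations on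
the first sets of a given sequence. -/
def approxMixing {N : ℕ} (ψ : Fin N → ℕ → ℤ) (lam : Fin N → ℝ) (C : ℕ → Set unitInterval)
    (m : ℕ) : Set Aut01 :=
  {T | ∃ k ≥ m, ∀ j, ∀ a : Fin (m + 1), ∀ b : Fin (m + 1),
    |T.corr (ψ j k) (C a) (C b) - partialCorr (lam j) (C a) (C b)| < 1 / ((m : ℝ) + 1)}

variable {N : ℕ} {ψ : Fin N → ℕ → ℤ} {lam : Fin N → ℝ} {C : ℕ → Set unitInterval}

theorem isOpen_approxMixing (hC : ∀ a, MeasurableSet (C a)) (m : ℕ) :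
    IsOpen (approxMixing ψ lam C m) := by
  have : approxMixing ψ lam C m = ⋃ k, ⋃ _ : k ≥ m, ⋂ j, ⋂ a : Fin (m + 1), ⋂ b : Fin (m + 1),
      {T | |T.corr (ψ j k) (C a) (C b) - partialCorr (lam j) (C a) (C b)| <
        1 / ((m : ℝ) + 1)} := by
    ext T
    simp [approxMixing]
  rw [this]
  refine isOpen_iUnion fun k => isOpen_iUnion fun _ => isOpen_iInter_of_finite fun j =>
    isOpen_iInter_of_finite fun a => isOpen_iInter_of_finite fun b => ?_
  exact isOpen_lt ((continuous_corr _ _ (hC b)).sub continuous_const).abs continuous_const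

theorem partiallyMixing_eq_iInter (hlam : ∀ j, lam j ∈ Icc (0 : ℝ) 1)
    (hC : (volume : Measure unitInterval).MeasureDense (range C)) :
    partiallyMixing ψ lam = ⋂ m, approxMixing ψ lam C m := by
  have hCm : ∀ a, MeasurableSet (C a) := fun a => hC.measurable _ (mem_range_self a)
  ext T
  rw [mem_iInter]
  constructor
  · rintro ⟨kseq, hk, hT⟩ m
    have h : ∀ᶠ ℓ in atTop, ∀ j, ∀ a : Fin (m + 1), ∀ b : Fin (m + 1),
        |T.corr (ψ j (kseq ℓ)) (C a) (C b) - partialCorr (lam j) (C a) (C b)| <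
          1 / ((m : ℝ) + 1) := by
      simp only [eventually_all]
      intro j a b
      have := Metric.tendsto_nhds.1 (hT j (C a) (C b) (hCm a) (hCm b)) (1 / ((m : ℝ) + 1))
        (by positivity)
      simpa only [Real.dist_eq] using this
    obtain ⟨ℓ, hℓ, hmℓ⟩ := (h.and (eventually_ge_atTop m)).exists
    exact ⟨kseq ℓ, hmℓ.trans (hk.id_le ℓ), hℓ⟩
  · intro hT
    have hfreq : ∀ m : ℕ, ∃ᶠ k in atTop, ∀ j, ∀ a ≤ m, ∀ b ≤ m,
        |T.corr (ψ j k) (C a) (C b) - partialCorr (lam j) (C a) (C b)| < 1 / ((m : ℝ) + 1) := by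
      intro m
      rw [frequently_atTop]
      intro M
      obtain ⟨k, hk, h⟩ := hT (max m M)
      refine ⟨k, (le_max_right _ _).trans hk, fun j a ha b hb => ?_⟩
      refine (h j ⟨a, by omega⟩ ⟨b, by omega⟩).trans_le ?_
      have : (m : ℝ) ≤ (max m M : ℕ) := by exact_mod_cast le_max_left m M
      gcongr
    obtain ⟨kseq, hk, h⟩ := extraction_forall_of_frequently hfreq
    refine ⟨kseq, hk, fun j A B hA hB => tendsto_corr_of_measureDense hC (hlam j) ?_ hA hB⟩
    rintro _ ⟨a, rfl⟩ _ ⟨b, rfl⟩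
    rw [tendsto_iff_dist_tendsto_zero]
    refine squeeze_zero' (Eventually.of_forall fun _ => dist_nonneg) ?_
      (tendsto_one_div_add_atTop_nhds_zero_nat (𝕜 := ℝ))
    filter_upwards [eventually_ge_atTop (max a b)] with ℓ hℓ
    rw [Real.dist_eq]
    exact (h ℓ j a (by omega) b (by omega)).le

theorem dense_preimage_approxMixing
    (hψ : ∀ ξ : Fin N → Bool, ∃ T, IsAut volume T ∧ IsAper volume T ∧ MixesAlong ψ ξ T)
    (hlam : ∀ j, lam j ∈ Icc (0 : ℝ) 1) (hC : ∀ a, MeasurableSet (C a)) (m : ℕ) :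
    Dense (AperAut.toAut ⁻¹' approxMixing ψ lam C m) := by
  rw [Metric.dense_iff]
  intro S r hr
  obtain ⟨T, hT, haT, hST, hlim⟩ := exists_close_mixing hψ hlam S.toAut.isAut S.aperiodic
    (C := fun a : Fin (m + 1) => C a) (fun a => hC a) (half_pos hr)
  refine ⟨⟨ofIsAut hT, haT⟩, ?_, ?_⟩
  · rw [Metric.mem_ball, dist_comm, AperAut.dist_eq]
    exact (ENNReal.toReal_le_of_le_ofReal (half_pos hr).le hST).trans_lt (half_lt_self hr)
  · have h : ∀ᶠ k in atTop, ∀ j, ∀ a : Fin (m + 1), ∀ b : Fin (m + 1),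
        |(ofIsAut hT).corr (ψ j k) (C a) (C b) - partialCorr (lam j) (C a) (C b)| <
          1 / ((m : ℝ) + 1) := by
      simp only [eventually_all]
      intro j a b
      have := Metric.tendsto_nhds.1 (hlim j a b) (1 / ((m : ℝ) + 1)) (by positivity)
      simp only [Real.dist_eq, ← mul_assoc] at this
      exact this
    obtain ⟨k, hk, hmk⟩ := (h.and (eventually_ge_atTop m)).exists
    exact ⟨k, hmk, hk⟩

theorem isGδ_and_dense_partiallyMixing
    (hψ : ∀ ξ : Fin N → Bool, ∃ T, IsAut volume T ∧ IsAper volume T ∧ MixesAlong ψ ξ T)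
    (hlam : ∀ j, lam j ∈ Icc (0 : ℝ) 1) :
    IsGδ (partiallyMixing ψ lam) ∧ Dense (partiallyMixing ψ lam) := by
  obtain ⟨𝒜, hcount, h𝒜⟩ := exists_countable_measureDense (volume : Measure unitInterval)
  obtain ⟨C, rfl⟩ := hcount.exists_eq_range h𝒜.nonempty
  have hC : ∀ a, MeasurableSet (C a) := fun a => h𝒜.measurable _ (mem_range_self a)
  rw [partiallyMixing_eq_iInter hlam h𝒜]
  refine ⟨IsGδ.iInter_of_isOpen (isOpen_approxMixing hC), ?_⟩
  obtain ⟨Q, hQ, haQ, -⟩ := hψ fun _ => false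
  have hdense : Dense (⋂ m, AperAut.toAut ⁻¹' approxMixing ψ lam C m) :=
    dense_iInter_of_isOpen_nat
      (fun m => (isOpen_approxMixing hC m).preimage AperAut.continuous_toAut)
      (dense_preimage_approxMixing hψ hlam hC)
  rw [dense_iff_inter_open]
  intro U hU hne
  obtain ⟨S, hSU, hS⟩ := (dense_aperiodic hQ haQ).inter_open_nonempty U hU hne
  obtain ⟨T, hTU, hT⟩ := hdense.inter_open_nonempty _ (hU.preimage AperAut.continuous_toAut)
    ⟨⟨S, hS⟩, hSU⟩
  exact ⟨T.toAut, hTU, by simpa using hT⟩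

end Aut01
end Residual

/-- If `φ_1,…,φ_N` satisfy Condition C along `(n_k)` (for every
`ξ ∈ {0,1}^N` there is an aperiodic `T_ξ` mixing along `φ_j(n_k)` for `ξ_j = 1` and
rigid for `ξ_j = 0`), then for any `λ_1,…,λ_N ∈ [0,1]` the set of `T` admitting a
subsequence `(n_{k_ℓ})` along which `μ(A ∩ T^{-φ_j(n_{k_ℓ})}B) → (1-λ_j)μ(A∩B) +
λ_j μ(A)μ(B)` is a dense `G_δ`. -/
theorem stmt_1 (N : ℕ) (lam : Fin N → ℝ) (hlam : ∀ j, lam j ∈ Set.Icc (0 : ℝ) 1)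
    (φ : Fin N → ℕ → ℤ) (n : ℕ → ℕ) (hn : StrictMono n)
    (hC : ∀ ξ : Fin N → ℝ, (∀ j, ξ j = 0 ∨ ξ j = 1) →
      ∃ T : Aut01, T.Aperiodic ∧
        ∀ j : Fin N, ∀ A B : Set unitInterval, MeasurableSet A → MeasurableSet B →
          Tendsto (fun k => T.corr (φ j (n k)) A B) atTop
            (𝓝 ((1 - ξ j) * (volume (A ∩ B)).toReal
              + ξ j * (volume A).toReal * (volume B).toReal))) :
    IsGδ {T : Aut01 | ∃ kseq : ℕ → ℕ, StrictMono kseq ∧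
        ∀ j : Fin N, ∀ A B : Set unitInterval, MeasurableSet A → MeasurableSet B →
          Tendsto (fun ℓ => T.corr (φ j (n (kseq ℓ))) A B) atTop
            (𝓝 ((1 - lam j) * (volume (A ∩ B)).toReal
              + lam j * (volume A).toReal * (volume B).toReal))} ∧
    Dense {T : Aut01 | ∃ kseq : ℕ → ℕ, StrictMono kseq ∧
        ∀ j : Fin N, ∀ A B : Set unitInterval, MeasurableSet A → MeasurableSet B →
          Tendsto (fun ℓ => T.corr (φ j (n (kseq ℓ))) A B) atTop
            (𝓝 ((1 - lam j) * (volume (A ∩ B)).toReal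
              + lam j * (volume A).toReal * (volume B).toReal))} := by
  refine Aut01.isGδ_and_dense_partiallyMixing (ψ := fun j k => φ j (n k)) (fun ξ => ?_) hlam
  obtain ⟨T, haT, hT⟩ := hC (fun j => if ξ j then 1 else 0) fun j => by cases ξ j <;> simp
  refine ⟨T.toEquiv, T.isAut, haT, fun j A B hA hB => ?_⟩
  have hlim : (if ξ j then volume.real A * volume.real B else volume.real (A ∩ B)) =
      (1 - if ξ j then 1 else 0) * (volume (A ∩ B)).toReal +
        (if ξ j then 1 else 0) * (volume A).toReal * (volume B).toReal := by
    cases ξ j <;> simp [measureReal_def]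
  rw [hlim]
  exact hT j A B hA hB
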